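/- arXiv:2408.13350 — 8 statements merged into one kernel-verified Lean document; each statement's English description precedes it below -/
import Mathlib

section
/- Let Γ be a group, S ⊆ Γ a symmetric subset (closed under inverses), ε ∈ (0,1), and H a complex Hilbert space. Let π : Γ → B(H) be an (S,ε)-representation. Then there exists a map σ : Γ → B(H) such that σ(g) is a unitary operator for every g ∈ Γ, σ is an (S,6ε)-representation, and ‖σ(s) − π(s)‖ < ε for all s ∈ S. -/
lemma polar_aux {H : Type*} [NormedAddCommGroup H]
    [InnerProductSpace ℂ H] [CompleteSpace H] (ε : ℝ) (hε1 : ε < 1)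
    (a c : H →L[ℂ] H) (ha : ‖a‖ ≤ 1) (hc : ‖c‖ ≤ 1)
    (h1 : ‖c * a - 1‖ < ε) (h2 : ‖a * c - 1‖ < ε) :
    ∃ u ∈ unitary (H →L[ℂ] H), ‖u - a‖ < ε := by
  have key : ∀ T : H →L[ℂ] H, ‖T - 1‖ < ε → IsUnit T := fun T hT => by
    have h : ‖1 - T‖ < 1 := by rw [norm_sub_rev]; linarith
    have := (Units.oneSub (1 - T) h).isUnit
    simpa using this
  have hau : IsUnit a := by
    obtain ⟨v, hv⟩ := key _ h1
    obtain ⟨w, hw⟩ := key _ h2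
    have hl : (↑v⁻¹ * c) * a = 1 := by rw [mul_assoc, ← hv]; simp
    have hr : a * (c * ↑w⁻¹) = 1 := by rw [← mul_assoc, ← hw]; simp
    have he := left_inv_eq_right_inv hl hr
    exact ⟨⟨a, c * ↑w⁻¹, hr, he ▸ hl⟩, rfl⟩
  set δ := ‖c * a - 1‖ with hδ
  have hδ0 : 0 ≤ δ := norm_nonneg _
  set b := CFC.abs a with hb
  have hb0 : 0 ≤ b := CFC.abs_nonneg a
  have hbb : b * b = star a * a := CFC.abs_mul_abs a
  have hbu : IsUnit b := (CFC.isUnit_sqrt_iff (star a * a) (star_mul_self_nonneg a)).2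
    (hau.star.mul hau)
  have hbs : star b = b := (IsSelfAdjoint.of_nonneg hb0).star_eq
  have hb1 : b ≤ 1 := (CStarAlgebra.norm_le_one_iff_of_nonneg b hb0).1
    (by rw [hb, CFC.norm_abs]; exact ha)
  have hlow : algebraMap ℝ (H →L[ℂ] H) (1 - δ) ≤ b := by
    have hP : 0 ≤ algebraMap ℝ (H →L[ℂ] H) (1 - δ) := algebraMap_nonneg _ (by linarith)
    rw [← CFC.sqrt_mul_self _ hP]
    apply CFC.sqrt_le_sqrt
    rw [ContinuousLinearMap.le_def, ContinuousLinearMap.isPositive_def']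
    refine ⟨?_, fun x => ?_⟩
    · apply IsSelfAdjoint.sub (IsSelfAdjoint.star_mul_self a)
      rw [← map_mul]
      exact IsSelfAdjoint.algebraMap _ (IsSelfAdjoint.all _)
    · have hx : (1 - δ) * ‖x‖ ≤ ‖a x‖ := by
        have e1 : ‖(c * a - 1) x‖ ≤ δ * ‖x‖ := ContinuousLinearMap.le_opNorm _ _
        have e2 : ‖c (a x)‖ ≤ 1 * ‖a x‖ := ContinuousLinearMap.le_of_opNorm_le _ hc _
        have e3 : ‖x‖ ≤ ‖c (a x)‖ + ‖(c * a - 1) x‖ := by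
          have : x = c (a x) - (c * a - 1) x := by simp
          calc ‖x‖ = ‖c (a x) - (c * a - 1) x‖ := by rw [← this]
            _ ≤ _ := norm_sub_le _ _
        linarith
      have hsq : ((1 - δ) * ‖x‖) ^ 2 ≤ ‖a x‖ ^ 2 :=
        pow_le_pow_left₀ (mul_nonneg (by linarith) (norm_nonneg _)) hx 2
      have : (star a * a - algebraMap ℝ (H →L[ℂ] H) (1 - δ) *
          algebraMap ℝ (H →L[ℂ] H) (1 - δ)).reApplyInnerSelf x
          = ‖a x‖ ^ 2 - ((1 - δ) * ‖x‖) ^ 2 := by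
        rw [← map_mul, Algebra.algebraMap_eq_smul_one, ContinuousLinearMap.reApplyInnerSelf_apply,
          ContinuousLinearMap.star_eq_adjoint, ContinuousLinearMap.sub_apply, inner_sub_left, map_sub,
          ContinuousLinearMap.mul_apply, ContinuousLinearMap.adjoint_inner_left,
          inner_self_eq_norm_sq, ContinuousLinearMap.smul_apply, ContinuousLinearMap.one_apply,
          inner_smul_left_eq_smul, RCLike.smul_re, inner_self_eq_norm_sq]
        ring
      rw [this]; linarith
  have hnorm : ‖1 - b‖ ≤ δ := by
    rw [CStarAlgebra.norm_le_iff_le_algebraMap _ hδ0 (sub_nonneg.2 hb1)]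
    rw [map_sub, map_one] at hlow
    exact sub_le_comm.1 hlow
  obtain ⟨v, hv⟩ := hbu
  have hvs : star (↑v⁻¹ : H →L[ℂ] H) = ↑v⁻¹ := by
    have : star v = v := Units.ext (by rw [Units.coe_star, hv, hbs])
    rw [← Units.coe_star, star_inv, this]
  have hus : star (a * ↑v⁻¹) * (a * ↑v⁻¹) = 1 := by
    rw [star_mul, hvs, mul_assoc, ← mul_assoc (star a), ← hbb, ← hv]
    simp
  have huu : IsUnit (a * (↑v⁻¹ : H →L[ℂ] H)) := hau.mul v⁻¹.isUnit
  have hum : a * (↑v⁻¹ : H →L[ℂ] H) ∈ unitary (H →L[ℂ] H) := by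
    refine Unitary.mem_iff.2 ⟨hus, ?_⟩
    obtain ⟨w, hw⟩ := huu
    rw [← hw] at hus ⊢
    have e : star (w : H →L[ℂ] H) = ↑w⁻¹ := by
      calc star (w : H →L[ℂ] H) = star (w : H →L[ℂ] H) * ↑w * ↑w⁻¹ := by rw [mul_assoc]; simp
        _ = ↑w⁻¹ := by rw [hus, one_mul]
    rw [e]; simp
  refine ⟨_, hum, ?_⟩
  have : a * (↑v⁻¹ : H →L[ℂ] H) - a = a * ↑v⁻¹ * (1 - b) := by
    rw [mul_sub, mul_one, mul_assoc, ← hv]; simp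
  rw [this, CStarRing.norm_mem_unitary_mul _ hum]
  linarith

/-- If `π : Γ → B(H)` is an `(S,ε)`-representation (a unital map into the
closed unit ball of `B(H)` that is `ε`-multiplicative on the symmetric set `S`), with
`0 < ε < 1`, then there is a unitary-valued `(S,6ε)`-representation `σ` with
`‖σ s − π s‖ < ε` for all `s ∈ S`. -/
theorem statement0 {Γ : Type*} [Group Γ] {H : Type*} [NormedAddCommGroup H]
    [InnerProductSpace ℂ H] [CompleteSpace H]
    (S : Set Γ) (hS : ∀ s ∈ S, s⁻¹ ∈ S) (ε : ℝ) (hε : ε ∈ Set.Ioo (0 : ℝ) 1)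
    (π : Γ → H →L[ℂ] H) (hπ1 : π 1 = 1) (hπball : ∀ g, ‖π g‖ ≤ 1)
    (hπmul : ∀ s ∈ S, ∀ t ∈ S, ‖π s * π t - π (s * t)‖ < ε) :
    ∃ σ : Γ → H →L[ℂ] H,
      (∀ g, σ g ∈ unitary (H →L[ℂ] H)) ∧
      σ 1 = 1 ∧ (∀ g, ‖σ g‖ ≤ 1) ∧
      (∀ s ∈ S, ∀ t ∈ S, ‖σ s * σ t - σ (s * t)‖ < 6 * ε) ∧
      (∀ s ∈ S, ‖σ s - π s‖ < ε) := by
  obtain ⟨hε0, hε1⟩ := hε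
  have hS' : ∀ s ∈ S, ∃ u ∈ unitary (H →L[ℂ] H), ‖u - π s‖ < ε := fun s hs =>
    polar_aux ε hε1 (π s) (π s⁻¹) (hπball _) (hπball _)
      (by simpa [hπ1] using hπmul _ (hS s hs) s hs) (by simpa [hπ1] using hπmul s hs _ (hS s hs))
  have hn : ∀ u ∈ unitary (H →L[ℂ] H), ‖u‖ ≤ 1 := fun u hu => by
    have := CStarRing.norm_mem_unitary_mul 1 hu
    rw [mul_one] at this
    rw [this]
    exact ContinuousLinearMap.norm_id_le
  have hprod : ∀ u ∈ unitary (H →L[ℂ] H), ∀ v ∈ unitary (H →L[ℂ] H), ∀ s ∈ S, ∀ t ∈ S,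
      ‖u - π s‖ < ε → ‖v - π t‖ < ε → ‖u * v - π (s * t)‖ < 3 * ε := by
    intro u hu v hv s hs t ht h1 h2
    have e : u * v - π (s * t) = u * (v - π t) + (u - π s) * π t + (π s * π t - π (s * t)) := by
      noncomm_ring
    have h3 : ‖(u - π s) * π t‖ ≤ ‖u - π s‖ :=
      (norm_mul_le _ _).trans (mul_le_of_le_one_right (norm_nonneg _) (hπball t))
    have h4 : ‖u * (v - π t)‖ ≤ ‖v - π t‖ :=
      (norm_mul_le _ _).trans (mul_le_of_le_one_left (norm_nonneg _) (hn u hu))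
    have h5 := hπmul s hs t ht
    rw [e]
    have := norm_add₃_le (a := u * (v - π t)) (b := (u - π s) * π t) (c := π s * π t - π (s * t))
    linarith
  have hall : ∀ g, ∃ u ∈ unitary (H →L[ℂ] H), (g = 1 → u = 1) ∧ (g ∈ S → ‖u - π g‖ < ε) ∧
      (∀ s ∈ S, ∀ t ∈ S, s * t = g → ‖u - π g‖ < 3 * ε) := by
    intro g
    by_cases hg1 : g = 1
    · subst hg1
      refine ⟨1, one_mem _, fun _ => rfl, fun _ => ?_, fun _ _ _ _ _ => ?_⟩
      · simpa [hπ1] using hε0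
      · simpa [hπ1] using hε0
    by_cases hgS : g ∈ S
    · obtain ⟨u, hu, hu'⟩ := hS' g hgS
      exact ⟨u, hu, fun h => absurd h hg1, fun _ => hu', fun _ _ _ _ _ => by linarith⟩
    by_cases hgSS : ∃ s ∈ S, ∃ t ∈ S, s * t = g
    · obtain ⟨s, hs, t, ht, rfl⟩ := hgSS
      obtain ⟨u, hu, hu'⟩ := hS' s hs
      obtain ⟨v, hv, hv'⟩ := hS' t ht
      exact ⟨u * v, mul_mem hu hv, fun h => absurd h hg1, fun h => absurd h hgS,
        fun _ _ _ _ _ => hprod u hu v hv s hs t ht hu' hv'⟩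
    · exact ⟨1, one_mem _, fun _ => rfl, fun h => absurd h hgS,
        fun s hs t ht h => absurd ⟨s, hs, t, ht, h⟩ hgSS⟩
  choose σ hσu hσ1 hσS hσSS using hall
  refine ⟨σ, hσu, hσ1 1 rfl, fun g => hn _ (hσu g), fun s hs t ht => ?_, hσS⟩
  have h1 := hprod _ (hσu s) _ (hσu t) s hs t ht (hσS s hs) (hσS t ht)
  have h2 := hσSS (s * t) s hs t ht rfl
  have := norm_sub_le_norm_sub_add_norm_sub (σ s * σ t) (π (s * t)) (σ (s * t))
  rw [norm_sub_rev (π (s * t))] at this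
  linarith
end

section
/- Let A be a unital C*-algebra, ε ∈ (0,1), and let a, b ∈ A satisfy ‖a‖ ≤ 1, ‖b‖ ≤ 1, ‖ab − 1‖ < ε and ‖ba − 1‖ < ε. Then a is invertible with ‖a⁻¹‖ < (1−ε)⁻¹, and there exists a unitary element u of A with ‖a − u‖ < ε. -/
theorem statement1 {A : Type*} [CStarAlgebra A]
    (ε : ℝ) (hε : ε ∈ Set.Ioo (0 : ℝ) 1) (a b : A)
    (ha : ‖a‖ ≤ 1) (hb : ‖b‖ ≤ 1)
    (hab : ‖a * b - 1‖ < ε) (hba : ‖b * a - 1‖ < ε) :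
    (∃ ha' : IsUnit a, ‖((ha'.unit⁻¹ : Aˣ) : A)‖ < (1 - ε)⁻¹) ∧
    ∃ u ∈ unitary A, ‖a - u‖ < ε := by
  obtain ⟨h0, h1⟩ := hε
  have key : ∀ x : A, ‖x - 1‖ < ε → IsUnit x := by
    intro x hx
    have h := isUnit_one_sub_of_norm_lt_one (x := 1 - x)
      (by rw [norm_sub_rev]; exact hx.trans h1)
    simpa using h
  have hua : IsUnit a := by
    obtain ⟨v, hv⟩ := key _ hab
    obtain ⟨w, hw⟩ := key _ hba
    refine isUnit_iff_exists_and_exists.mpr ⟨⟨b * ↑v⁻¹, ?_⟩, ⟨↑w⁻¹ * b, ?_⟩⟩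
    · rw [← mul_assoc, ← hv, Units.mul_inv]
    · rw [mul_assoc, ← hw, Units.inv_mul]
  obtain ⟨v, rfl⟩ := hua
  have hc : ‖((v⁻¹ : Aˣ) : A)‖ < (1 - ε)⁻¹ := by
    have e : ((v⁻¹ : Aˣ) : A) = b - (v⁻¹ : Aˣ) * (v * b - 1) := by
      rw [mul_sub, ← mul_assoc, Units.inv_mul]; simp
    have h2 : ‖((v⁻¹ : Aˣ) : A)‖ ≤ 1 + ‖((v⁻¹ : Aˣ) : A)‖ * ‖(v : A) * b - 1‖ := by
      conv_lhs => rw [e]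
      exact (norm_sub_le _ _).trans (add_le_add hb (norm_mul_le _ _))
    have hn := norm_nonneg ((v⁻¹ : Aˣ) : A)
    rw [← one_div (1 - ε), lt_div_iff₀ (by linarith)]
    rcases hn.eq_or_lt with h | h
    · rw [← h]; simp
    · nlinarith
  refine ⟨⟨v.isUnit, by simpa using hc⟩, ?_⟩
  cases subsingleton_or_nontrivial A
  · exact ⟨1, one_mem _, by simpa [Subsingleton.elim ((v : A) - 1) 0] using h0⟩
  letI := CStarAlgebra.spectralOrder A
  haveI := CStarAlgebra.spectralOrderedRing A
  have hpp : CFC.abs (v : A) * CFC.abs (v : A) = star (v : A) * v := CFC.abs_mul_abs _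
  have hp0 : 0 ≤ CFC.abs (v : A) := CFC.abs_nonneg _
  have hpn : ‖CFC.abs (v : A)‖ ≤ 1 := by rw [CFC.norm_abs]; exact ha
  have hpu : IsUnit (CFC.abs (v : A)) := by
    have : IsUnit (CFC.abs (v : A) * CFC.abs (v : A)) := by
      rw [hpp]; exact v.isUnit.star.mul v.isUnit
    exact ((Commute.refl _).isUnit_mul_iff.mp this).1
  have hps : star (CFC.abs (v : A)) = CFC.abs (v : A) := hp0.isSelfAdjoint
  generalize CFC.abs (v : A) = q at *
  obtain ⟨p, rfl⟩ := hpu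
  have hpis : star ((p⁻¹ : Aˣ) : A) = (p⁻¹ : Aˣ) := by
    have : star p = p := Units.ext hps
    rw [← Units.coe_star, star_inv, this]
  have hu : (v * (p⁻¹ : Aˣ) : A) ∈ unitary A := by
    have h3 : star (v * (p⁻¹ : Aˣ) : A) * (v * (p⁻¹ : Aˣ) : A) = 1 := by
      rw [star_mul, hpis, mul_assoc, ← mul_assoc (star (v : A)), ← hpp]
      simp
    have h4 : IsUnit (v * (p⁻¹ : Aˣ) : A) := (v * p⁻¹).isUnit
    exact ⟨h3, by
      apply h4.mul_right_cancel
      rw [mul_assoc, h3, mul_one, one_mul]⟩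
  refine ⟨_, hu, ?_⟩
  have e1 : (v - v * (p⁻¹ : Aˣ) : A) = (v * (p⁻¹ : Aˣ) : A) * (p - 1) := by
    rw [mul_sub, mul_assoc, Units.inv_mul]; simp
  rw [e1, CStarRing.norm_mem_unitary_mul _ hu]
  have hpi : ‖((p⁻¹ : Aˣ) : A)‖ < (1 - ε)⁻¹ := by
    have : ((p⁻¹ : Aˣ) : A) = (v⁻¹ : Aˣ) * (v * (p⁻¹ : Aˣ)) := by simp
    rw [this, CStarRing.norm_mul_mem_unitary _ hu]
    exact hc
  have hsa : IsSelfAdjoint (p : A) := hps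
  have e2 : (p - 1 : A) = cfc (fun x : ℝ => x - 1) (p : A) := by
    rw [cfc_sub .., cfc_id' .., cfc_const_one ..]
  rw [e2, norm_cfc_lt_iff _ _ h0]
  intro x hx
  have hx0 : 0 ≤ x := spectrum_nonneg_of_nonneg hp0 hx
  have hx1 : x ≤ 1 := (le_abs_self x).trans ((spectrum.norm_le_norm_of_mem hx).trans hpn)
  have hxne : x ≠ 0 := spectrum.ne_zero_of_mem_of_unit hx
  have hxi : x⁻¹ ∈ spectrum ℝ ((p⁻¹ : Aˣ) : A) := by
    have := spectrum.inv_mem_iff (r := Units.mk0 x hxne) (a := p)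
    simpa using this.mp (by simpa using hx)
  have h5 : x⁻¹ < (1 - ε)⁻¹ :=
    ((le_abs_self _).trans (spectrum.norm_le_norm_of_mem hxi)).trans_lt hpi
  have h6 : 1 - ε < x := (inv_lt_inv₀ (lt_of_le_of_ne hx0 hxne.symm) (by linarith)).mp h5
  rw [Real.norm_eq_abs, abs_lt]
  constructor <;> linarith
end

section
/- Let A and B be unital C*-algebras and φ : A → B a unital completely positive map. Let X ⊆ A and ε > 0 be such that ‖φ(aa*) − φ(a)φ(a)*‖ < ε and ‖φ(a*a) − φ(a)*φ(a)‖ < ε for all a ∈ X. Then ‖φ(ab) − φ(a)φ(b)‖ ≤ √ε·‖b‖ and ‖φ(ba) − φ(b)φ(a)‖ ≤ √ε·‖b‖ for all b ∈ A and a ∈ X. -/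
/-- A linear map `φ : A → B` between unital C*-algebras is *unital completely positive*
if `φ 1 = 1` and, for every `k`, applying `φ` entrywise to `k × k` matrices sends positive
elements of `M_k(A)` (i.e. elements of the form `star y * y`) to positive elements of
`M_k(B)`. -/
def IsUcpMap {A B : Type*} [CStarAlgebra A] [CStarAlgebra B] (φ : A →ₗ[ℂ] B) : Prop :=
  φ 1 = 1 ∧
    ∀ (k : ℕ) (m : Matrix (Fin k) (Fin k) A),
      (∃ y : Matrix (Fin k) (Fin k) A, m = star y * y) →
      ∃ z : Matrix (Fin k) (Fin k) B, m.map φ = star z * z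

section aux
attribute [local instance] CStarAlgebra.spectralOrder CStarAlgebra.spectralOrderedRing

variable {A B : Type*} [CStarAlgebra A] [CStarAlgebra B]

lemma ucp_matrix {φ : A →ₗ[ℂ] B} (hφ : IsUcpMap φ) (x : Fin 3 → A) :
    ∃ z : Matrix (Fin 3) (Fin 3) B, ∀ i j, φ (star (x i) * x j) = ∑ k, star (z k i) * z k j := by
  obtain ⟨z, hz⟩ := hφ.2 3 (Matrix.of fun i j => star (x i) * x j)
    ⟨Matrix.of fun i j => if i = 0 then x j else 0, by
      ext i j
      simp [Matrix.mul_apply, Matrix.star_apply, Fin.sum_univ_three]⟩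
  refine ⟨z, fun i j => ?_⟩
  have := congrFun (congrFun hz i) j
  simpa [Matrix.mul_apply, Matrix.star_apply] using this

lemma ucp_star {φ : A →ₗ[ℂ] B} (hφ : IsUcpMap φ) (x y : A) :
    φ (star y * x) = star (φ (star x * y)) := by
  obtain ⟨z, hz⟩ := ucp_matrix hφ ![x, y, 0]
  have h1 := hz 0 1
  have h2 := hz 1 0
  simp only [Matrix.cons_val_zero, Matrix.cons_val_one] at h1 h2
  rw [h1, h2]
  simp [star_sum]

lemma ucp_star' {φ : A →ₗ[ℂ] B} (hφ : IsUcpMap φ) (x : A) :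
    φ (star x) = star (φ x) := by
  simpa using ucp_star hφ 1 x

lemma ucp_pos {φ : A →ₗ[ℂ] B} (hφ : IsUcpMap φ) (x : Fin 3 → A) (v : Fin 3 → B) :
    0 ≤ ∑ i, ∑ j, star (v i) * φ (star (x i) * x j) * v j := by
  obtain ⟨z, hz⟩ := ucp_matrix hφ x
  have : ∑ i, ∑ j, star (v i) * φ (star (x i) * x j) * v j
      = ∑ k, star (∑ j, z k j * v j) * (∑ j, z k j * v j) := by
    simp only [hz, Fin.sum_univ_three, star_add, star_mul]
    noncomm_ring
  rw [this]
  exact Finset.sum_nonneg fun k _ => star_mul_self_nonneg _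

lemma ucp_nonneg {φ : A →ₗ[ℂ] B} (hφ : IsUcpMap φ) (w : A) : 0 ≤ φ (star w * w) := by
  simpa [Fin.sum_univ_three] using ucp_pos hφ ![w, 0, 0] ![1, 0, 0]

lemma ucp_le {φ : A →ₗ[ℂ] B} (hφ : IsUcpMap φ) (y : A) :
    φ (star y * y) ≤ (‖y‖ ^ 2 : ℝ) • (1 : B) := by
  have h : star y * y ≤ algebraMap ℝ A (‖y‖ ^ 2) := by
    have := (IsSelfAdjoint.star_mul_self y).le_algebraMap_norm_self
    rwa [CStarRing.norm_star_mul_self, ← sq] at this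
  obtain ⟨w, hw⟩ := CStarAlgebra.nonneg_iff_eq_star_mul_self.mp (sub_nonneg.mpr h)
  have h2 := ucp_nonneg hφ w
  rw [← hw, map_sub, sub_nonneg] at h2
  refine h2.trans (le_of_eq ?_)
  rw [Algebra.algebraMap_eq_smul_one, ← Complex.coe_smul, map_smul, hφ.1, Complex.coe_smul]

lemma ucp_key {φ : A →ₗ[ℂ] B} (hφ : IsUcpMap φ) (x y : A) (c d : B) :
    0 ≤ star c * (φ (star x * x) - star (φ x) * φ x) * c
      + star c * (φ (star x * y) - star (φ x) * φ y) * d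
      + star d * star (φ (star x * y) - star (φ x) * φ y) * c
      + star d * (φ (star y * y) - star (φ y) * φ y) * d := by
  have h := ucp_pos hφ ![1, x, y] ![-(φ x * c + φ y * d), c, d]
  refine h.trans (le_of_eq ?_)
  simp only [Fin.sum_univ_three, Matrix.cons_val_zero, Matrix.cons_val_one, Matrix.cons_val,
    star_one, one_mul, mul_one, hφ.1, ucp_star' hφ, ucp_star hφ x y, star_neg, star_add, star_mul,
    star_sub, star_star]
  noncomm_ring

lemma ucp_main {φ : A →ₗ[ℂ] B} (hφ : IsUcpMap φ) (x y : A) {ε : ℝ} (hε : 0 < ε)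
    (h : ‖φ (star x * x) - star (φ x) * φ x‖ < ε) :
    ‖φ (star x * y) - star (φ x) * φ y‖ ≤ Real.sqrt ε * ‖y‖ := by
  set T := φ (star x * y) - star (φ x) * φ y with hT
  have key := ucp_key hφ x y T (-(ε • (1 : B)))
  rw [← hT] at key
  have hP : φ (star x * x) - star (φ x) * φ x ≤ algebraMap ℝ B ε := by
    have hs : IsSelfAdjoint (φ (star x * x) - star (φ x) * φ x) := by
      have := ucp_star hφ x x
      rw [isSelfAdjoint_iff, star_sub, ← this]; simp
    exact hs.le_algebraMap_norm_self.trans (algebraMap_mono B h.le)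
  have hP' := star_left_conjugate_le_conjugate hP T
  have hQ : φ (star y * y) - star (φ y) * φ y ≤ (‖y‖ ^ 2 : ℝ) • (1 : B) :=
    (sub_le_self _ (star_mul_self_nonneg _)).trans (ucp_le hφ y)
  have hQ' := smul_le_smul_of_nonneg_left hQ (sq_nonneg ε)
  set P := φ (star x * x) - star (φ x) * φ x
  set Q := φ (star y * y) - star (φ y) * φ y
  have e1 : star T * P * T + star T * T * (-(ε • (1 : B))) + star (-(ε • (1 : B))) * star T * T
      + star (-(ε • (1 : B))) * Q * (-(ε • (1 : B)))
      = star T * P * T - (2 * ε) • (star T * T) + ε ^ 2 • Q := by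
    simp [smul_smul]
    module
  rw [e1] at key
  have e2 : star T * algebraMap ℝ B ε * T = ε • (star T * T) := by
    simp [Algebra.algebraMap_eq_smul_one]
  rw [e2] at hP'
  have h3 : 0 ≤ ε • (star T * T) - (2 * ε) • (star T * T) + ε ^ 2 • ((‖y‖ ^ 2 : ℝ) • (1 : B)) :=
    key.trans (by gcongr)
  have h4 : star T * T ≤ algebraMap ℝ B (ε * ‖y‖ ^ 2) := by
    rw [← sub_nonneg]
    have := smul_nonneg (inv_nonneg.mpr hε.le) h3
    refine this.trans (le_of_eq ?_)
    rw [Algebra.algebraMap_eq_smul_one]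
    match_scalars <;> field_simp <;> ring
  have h5 : ‖star T * T‖ ≤ ε * ‖y‖ ^ 2 :=
    (CStarAlgebra.norm_le_iff_le_algebraMap _ (by positivity) (star_mul_self_nonneg _)).mpr h4
  rw [CStarRing.norm_star_mul_self] at h5
  apply le_of_sq_le_sq _ (by positivity)
  rw [mul_pow, Real.sq_sqrt hε.le]
  linarith

end aux

/-- If `φ : A → B` is ucp and `X ⊆ A`, `ε > 0` are such that
`‖φ(aa*) − φ(a)φ(a)*‖ < ε` and `‖φ(a*a) − φ(a)*φ(a)‖ < ε` for all `a ∈ X`, then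
`‖φ(ab) − φ(a)φ(b)‖ ≤ √ε·‖b‖` and `‖φ(ba) − φ(b)φ(a)‖ ≤ √ε·‖b‖` for all `b ∈ A`,
`a ∈ X`. -/
theorem statement4 {A B : Type*} [CStarAlgebra A] [CStarAlgebra B]
    (φ : A →ₗ[ℂ] B) (hφ : IsUcpMap φ)
    (X : Set A) (ε : ℝ) (hε : 0 < ε)
    (h1 : ∀ a ∈ X, ‖φ (a * star a) - φ a * star (φ a)‖ < ε)
    (h2 : ∀ a ∈ X, ‖φ (star a * a) - star (φ a) * φ a‖ < ε) :
    ∀ b : A, ∀ a ∈ X,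
      ‖φ (a * b) - φ a * φ b‖ ≤ Real.sqrt ε * ‖b‖ ∧
      ‖φ (b * a) - φ b * φ a‖ ≤ Real.sqrt ε * ‖b‖ := by
  intro b a ha
  constructor
  · have := ucp_main hφ (star a) b hε (by simpa [ucp_star' hφ] using h1 a ha)
    simpa [ucp_star' hφ] using this
  · have := ucp_main hφ a (star b) hε (h2 a ha)
    rw [← norm_star] at this
    simpa [ucp_star' hφ, ← ucp_star hφ a (star b)] using this
end

section
/- Let δ ∈ (0,1/2), let A be a unital C*-algebra, and let a ∈ A be a self-adjoint element whose spectrum does not intersect the open interval (δ, 1−δ). Let χ be the characteristic function of (1/2,∞); since the spectrum of a avoids a neighbourhood of 1/2, χ is continuous on the spectrum of a and χ(a) is defined by the continuous functional calculus. Then for every b ∈ A one has ‖χ(a)b − bχ(a)‖ ≤ (1/(1−2δ))·‖ab − ba‖. -/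
/-- Let `δ ∈ (0,1/2)` and let `a` be a self-adjoint element of a unital
C*-algebra whose spectrum avoids `(δ, 1−δ)`.  Let `χ(a)` be obtained by applying the
characteristic function of `(1/2, ∞)` to `a` via the continuous functional calculus.  Then
`‖χ(a)b − bχ(a)‖ ≤ (1/(1−2δ))·‖ab − ba‖` for every `b`. -/
theorem statement8 {A : Type*} [CStarAlgebra A]
    (δ : ℝ) (hδ : δ ∈ Set.Ioo (0 : ℝ) (1 / 2))
    (a : A) (ha : IsSelfAdjoint a)
    (hspec : ∀ r ∈ spectrum ℝ a, r ∉ Set.Ioo δ (1 - δ)) (b : A) :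
    ‖cfc (fun r : ℝ => if 1 / 2 < r then (1 : ℝ) else 0) a * b -
        b * cfc (fun r : ℝ => if 1 / 2 < r then (1 : ℝ) else 0) a‖ ≤
      (1 / (1 - 2 * δ)) * ‖a * b - b * a‖ := by
  obtain ⟨hδ0, hδ1⟩ := hδ
  have hcS : ContinuousOn (fun r : ℝ => if 1 / 2 < r then (1 : ℝ) else -1) (spectrum ℝ a) := by
    intro r hr
    have h1 := hspec r hr
    apply ContinuousAt.continuousWithinAt
    rcases lt_or_ge (1 / 2) r with h | h
    · apply (continuousAt_const (y := (1 : ℝ))).congr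
      filter_upwards [lt_mem_nhds h] with x hx
      simp only [if_pos hx]
    · have h2 : r < 1 / 2 := by
        rcases h.lt_or_eq with h | h
        · exact h
        · exact absurd ⟨by linarith, by linarith⟩ h1
      apply (continuousAt_const (y := (-1 : ℝ))).congr
      filter_upwards [gt_mem_nhds h2] with x hx
      rw [if_neg (not_lt.mpr (le_of_lt hx))]
  have hcH : ContinuousOn (fun r : ℝ => |r - 1 / 2|) (spectrum ℝ a) := by fun_prop
  set s : A := cfc (fun r : ℝ => if 1 / 2 < r then (1 : ℝ) else -1) a with hs
  set h : A := cfc (fun r : ℝ => |r - 1 / 2|) a with hh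
  have hp : cfc (fun r : ℝ => if 1 / 2 < r then (1 : ℝ) else 0) a = (1 / 2 : ℝ) • (1 + s) := by
    rw [hs, ← cfc_const_one ℝ a, ← cfc_add (a := a) _ _ (by fun_prop) hcS,
      ← cfc_smul (a := a) _ (fun x : ℝ => 1 + if 1 / 2 < x then (1 : ℝ) else -1)
        (continuousOn_const.add hcS)]
    apply cfc_congr
    intro r _
    by_cases hr : 1 / 2 < r
    · simp only [if_pos hr, smul_eq_mul]; norm_num
    · simp only [if_neg hr, smul_eq_mul]; norm_num
  have hss : s * s = 1 := by
    rw [hs, ← cfc_mul (a := a) _ _ hcS hcS, ← cfc_const_one ℝ a]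
    apply cfc_congr
    intro r _
    by_cases hr : 1 / 2 < r
    · simp only [if_pos hr]; norm_num
    · simp only [if_neg hr]; norm_num
  have hcomm : s * h = h * s := cfc_commute_cfc _ _ a
  have haeq : a = h * s + (1 / 2 : ℝ) • (1 : A) := by
    have e : (1 / 2 : ℝ) • (1 : A) = cfc (fun _ : ℝ => (1 / 2 : ℝ)) a := by
      rw [cfc_const _ a, Algebra.algebraMap_eq_smul_one]
    rw [e, hs, hh, ← cfc_mul (a := a) _ _ hcH hcS,
      ← cfc_add (a := a) (fun x : ℝ => |x - 1 / 2| * if 1 / 2 < x then (1 : ℝ) else -1)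
        (fun _ => 1 / 2) (hcH.mul hcS) (by fun_prop)]
    conv_lhs => rw [← cfc_id ℝ a]
    apply cfc_congr
    intro r _
    by_cases hr : 1 / 2 < r
    · simp only [if_pos hr, id]; rw [abs_of_pos (by linarith)]; ring
    · simp only [if_neg hr, id]; rw [abs_of_nonpos (by linarith)]; ring
  have hsn : ‖s‖ ≤ 1 := by
    apply norm_cfc_le zero_le_one
    intro r _
    by_cases hr : 1 / 2 < r
    · simp only [if_pos hr]; simp
    · simp only [if_neg hr]; simp
  obtain ⟨M, hM⟩ : ∃ M : ℝ, ∀ r ∈ spectrum ℝ a, |r - 1 / 2| ≤ M := by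
    have hb := (ContinuousFunctionalCalculus.isCompact_spectrum (R := ℝ) a).bddAbove_image hcH
    obtain ⟨M, hM⟩ := hb
    exact ⟨M, fun r hr => hM ⟨r, hr, rfl⟩⟩
  obtain ⟨N, hMN, hN⟩ : ∃ N : ℝ, M ≤ N ∧ 1 ≤ N := ⟨max M 1, le_max_left _ _, le_max_right _ _⟩
  have hNh : ‖N • (1 : A) - h‖ ≤ N - (1 / 2 - δ) := by
    have e : N • (1 : A) = cfc (fun _ : ℝ => N) a := by
      rw [cfc_const _ a, Algebra.algebraMap_eq_smul_one]
    rw [e, hh, ← cfc_sub (a := a) _ _ (by fun_prop) hcH]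
    apply norm_cfc_le (by linarith)
    intro r hr
    have h1 := hM r hr
    have h2 : 1 / 2 - δ ≤ |r - 1 / 2| := by
      by_contra hc
      rw [not_le, abs_lt] at hc
      exact hspec r hr ⟨by linarith [hc.1], by linarith [hc.2]⟩
    rw [Real.norm_eq_abs, abs_of_nonneg (by linarith)]
    linarith
  set y : A := s * b - b * s with hy
  set z : A := a * b - b * a with hz
  have hz' : z = h * s * b - b * (h * s) := by
    rw [hz, haeq]
    simp only [add_mul, mul_add, smul_mul_assoc, mul_smul_comm, one_mul, mul_one]
    abel
  have hkey : h * y + y * h = z - s * z * s := by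
    have e1 : s * (h * s * b) * s = h * b * s := by
      rw [← mul_assoc, ← mul_assoc, hcomm, mul_assoc h s s, hss, mul_one]
    have e2 : s * (b * (h * s)) * s = s * b * h := by
      rw [mul_assoc, mul_assoc b, mul_assoc h, hss, mul_one, mul_assoc]
    have e3 : s * z * s = h * b * s - s * b * h := by
      rw [hz', mul_sub, sub_mul, e1, e2]
    have e4 : b * (h * s) = b * s * h := by rw [← hcomm, mul_assoc]
    rw [e3, hz', e4, hy]
    simp only [mul_sub, sub_mul, ← mul_assoc]
    abel
  have hup : ‖h * y + y * h‖ ≤ 2 * ‖z‖ := by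
    rw [hkey]
    have h1 : ‖s * z * s‖ ≤ ‖z‖ := by
      calc ‖s * z * s‖ ≤ ‖s‖ * ‖z‖ * ‖s‖ := norm_mul₃_le
        _ ≤ 1 * ‖z‖ * 1 := by gcongr
        _ = ‖z‖ := by ring
    linarith [norm_sub_le z (s * z * s)]
  have hlow : 2 * N * ‖y‖ ≤ ‖h * y + y * h‖ + 2 * ((N - (1 / 2 - δ)) * ‖y‖) := by
    have e : (2 * N) • y = (h * y + y * h) + ((N • (1 : A) - h) * y + y * (N • (1 : A) - h)) := by
      simp only [sub_mul, mul_sub, smul_mul_assoc, mul_smul_comm, one_mul, mul_one, two_mul,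
        add_smul]
      abel
    have e2 : ‖(2 * N) • y‖ = 2 * N * ‖y‖ := by
      rw [norm_smul, Real.norm_eq_abs, abs_of_nonneg (by linarith)]
    rw [← e2, e]
    have n1 : ‖(N • (1 : A) - h) * y‖ ≤ (N - (1 / 2 - δ)) * ‖y‖ :=
      (norm_mul_le _ _).trans (by gcongr)
    have n2 : ‖y * (N • (1 : A) - h)‖ ≤ (N - (1 / 2 - δ)) * ‖y‖ := by
      rw [mul_comm (N - (1 / 2 - δ))]
      exact (norm_mul_le _ _).trans (by gcongr)
    refine (norm_add_le _ _).trans ?_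
    linarith [norm_add_le ((N • (1 : A) - h) * y) (y * (N • (1 : A) - h))]
  have hfin : cfc (fun r : ℝ => if 1 / 2 < r then (1 : ℝ) else 0) a * b -
        b * cfc (fun r : ℝ => if 1 / 2 < r then (1 : ℝ) else 0) a = (1 / 2 : ℝ) • y := by
    rw [hp, smul_mul_assoc, mul_smul_comm, ← smul_sub, add_mul, mul_add, one_mul, mul_one,
      add_sub_add_left_eq_sub]
  rw [hfin, norm_smul, Real.norm_eq_abs, abs_of_pos (by norm_num),
    div_mul_eq_mul_div 1 (1 - 2 * δ), one_mul ‖z‖,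
    le_div_iff₀ (by linarith)]
  nlinarith
end

section
/- Let A be a unital C*-algebra, X a finite self-adjoint subset of the closed unit ball of A, and ε > 0. Let p, q be projections in A such that ‖p − q‖ < 1/4, and such that ‖px − xp‖ < ε and ‖qx − xq‖ < ε for all x ∈ X. Then there exists a unitary u ∈ A such that u p u* = q and ‖ux − xu‖ < 28ε for all x ∈ X. -/
theorem aux_sqrt {A : Type*} [CStarAlgebra A] [Nontrivial A] (d p q : A) (hd : IsSelfAdjoint d)
    (hn : ‖d‖ ≤ 1 / 16) (hp : Commute d p) (hq : Commute d q) :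
    ∃ t : A, star t = t ∧ t * p = p * t ∧ t * q = q * t ∧ ‖t‖ ≤ 1 / 16 ∧
      (1 - t) * (1 - t) = 1 - d := by
  have hs : ∀ x ∈ spectrum ℝ d, |x| ≤ 1 / 16 := fun x hx =>
    (spectrum.norm_le_norm_of_mem hx).trans hn
  have hc : ContinuousOn (fun x : ℝ => 1 - Real.sqrt (1 - x)) (spectrum ℝ d) := by fun_prop
  refine ⟨cfc (fun x : ℝ => 1 - Real.sqrt (1 - x)) d, ?_, ?_, ?_, ?_, ?_⟩
  · exact (cfc_predicate (R := ℝ) _ d : IsSelfAdjoint _)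
  · exact (hp.cfc_real _).eq
  · exact (hq.cfc_real _).eq
  · refine norm_cfc_le (by norm_num) fun x hx => ?_
    have h := hs x hx
    have h2 := abs_le.1 h
    have h0 := Real.sqrt_nonneg (1 - x)
    have h1 := Real.sq_sqrt (show (0 : ℝ) ≤ 1 - x by linarith)
    rw [Real.norm_eq_abs, abs_le]
    constructor <;> nlinarith
  · have e1 : (1 : A) - cfc (fun x : ℝ => 1 - Real.sqrt (1 - x)) d
        = cfc (fun x : ℝ => Real.sqrt (1 - x)) d := by
      rw [cfc_sub (fun _ : ℝ => (1 : ℝ)) (fun x : ℝ => Real.sqrt (1 - x)) d, cfc_const_one ℝ d]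
      abel
    rw [e1, ← cfc_mul (fun x : ℝ => Real.sqrt (1 - x)) (fun x : ℝ => Real.sqrt (1 - x)) d]
    have e2 : (1 : A) - d = cfc (fun x : ℝ => 1 - x) d := by
      rw [cfc_sub (fun _ : ℝ => (1 : ℝ)) (fun x : ℝ => x) d, cfc_const_one ℝ d, cfc_id' ℝ d]
    rw [e2]
    refine cfc_congr fun x hx => ?_
    have h2 := abs_le.1 (hs x hx)
    exact Real.mul_self_sqrt (by linarith)


/-- Let `A` be a unital C*-algebra, `X` a finite self-adjoint subset of the
closed unit ball of `A`, and `ε > 0`.  If `p, q` are projections with `‖p − q‖ < 1/4` that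
`ε`-commute with every `x ∈ X`, then there is a unitary `u` with `u p u* = q` and
`‖ux − xu‖ < 28ε` for all `x ∈ X`. -/
theorem statement9 {A : Type*} [CStarAlgebra A]
    (X : Set A) (hXfin : X.Finite) (hXsa : ∀ x ∈ X, star x ∈ X)
    (hXball : ∀ x ∈ X, ‖x‖ ≤ 1) (ε : ℝ) (hε : 0 < ε)
    (p q : A) (hp_idem : p * p = p) (hp_sa : star p = p)
    (hq_idem : q * q = q) (hq_sa : star q = q)
    (hpq : ‖p - q‖ < 1 / 4)
    (hpX : ∀ x ∈ X, ‖p * x - x * p‖ < ε)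
    (hqX : ∀ x ∈ X, ‖q * x - x * q‖ < ε) :
    ∃ u ∈ unitary A, u * p * star u = q ∧ ∀ x ∈ X, ‖u * x - x * u‖ < 28 * ε := by
  rcases subsingleton_or_nontrivial A with hA | hA
  · refine ⟨1, one_mem _, Subsingleton.elim _ _, fun x _ => ?_⟩
    rw [Subsingleton.elim (1 * x - x * 1) 0, norm_zero]
    linarith
  obtain ⟨d, hd⟩ : ∃ d, d = (p - q) * (p - q) := ⟨_, rfl⟩
  have hdsa : IsSelfAdjoint d := by
    rw [hd, IsSelfAdjoint, star_mul, star_sub, hp_sa, hq_sa]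
  have hn0 := norm_nonneg (p - q)
  have hdn : ‖d‖ ≤ 1 / 16 := by
    rw [hd]
    refine (norm_mul_le _ _).trans ?_
    nlinarith
  have hd' : d = p - p * q - q * p + q := by
    rw [hd, sub_mul, mul_sub, mul_sub, hp_idem, hq_idem]; abel
  have hpqp : ∀ y : A, p * (p * y) = p * y := fun y => by rw [← mul_assoc, hp_idem]
  have hqqq : ∀ y : A, q * (q * y) = q * y := fun y => by rw [← mul_assoc, hq_idem]
  have hdp : Commute d p := by
    rw [Commute, SemiconjBy, hd']
    simp only [sub_mul, add_mul, mul_sub, mul_add, mul_assoc, hp_idem, hq_idem, hpqp, hqqq]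
    abel
  have hdq : Commute d q := by
    rw [Commute, SemiconjBy, hd']
    simp only [sub_mul, add_mul, mul_sub, mul_add, mul_assoc, hp_idem, hq_idem, hpqp, hqqq]
    abel
  obtain ⟨t, htsa, htp, htq, htn, ht⟩ := aux_sqrt d p q hdsa hdn hdp hdq
  obtain ⟨v, hv⟩ : ∃ v, v = 1 - p - q + (q * p + q * p) := ⟨_, rfl⟩
  have hvs : star v = 1 - p - q + (p * q + p * q) := by
    simp [hv, hp_sa, hq_sa]
  have h1 : star v * v = 1 - d := by
    rw [hvs, hv, hd']
    simp only [sub_mul, add_mul, mul_sub, mul_add, mul_assoc, hp_idem, hq_idem, hpqp, hqqq,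
      one_mul, mul_one]
    abel
  have h2 : v * star v = 1 - d := by
    rw [hvs, hv, hd']
    simp only [sub_mul, add_mul, mul_sub, mul_add, mul_assoc, hp_idem, hq_idem, hpqp, hqqq,
      one_mul, mul_one]
    abel
  have hvp : v * p = q * v := by
    rw [hv]
    simp only [sub_mul, add_mul, mul_sub, mul_add, mul_assoc, hp_idem, hqqq, hq_idem,
      one_mul, mul_one]
    abel
  obtain ⟨s, hs⟩ : ∃ s, s = 1 - t := ⟨_, rfl⟩
  rw [← hs] at ht
  have hssa : star s = s := by simp [hs, htsa]
  have hsp : Commute s p := by rw [hs]; exact (Commute.one_left p).sub_left htp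
  have hsq : Commute s q := by rw [hs]; exact (Commute.one_left q).sub_left htq
  have hsv : Commute s v := by
    rw [hv]
    exact (((Commute.one_right s).sub_right hsp).sub_right hsq).add_right
      ((hsq.mul_right hsp).add_right (hsq.mul_right hsp))
  obtain ⟨U, hU⟩ : IsUnit s := by
    rw [hs]
    exact ⟨Units.oneSub t (by linarith), rfl⟩
  obtain ⟨w, hw⟩ : ∃ w : A, w = ↑U⁻¹ := ⟨_, rfl⟩
  have hws : w * s = 1 := by rw [hw, ← hU]; simp
  have hsw : s * w = 1 := by rw [hw, ← hU]; simp
  have hwsa : star w = w := by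
    have e : s * star w = 1 := by
      have := congrArg star hws
      simpa [hssa] using this
    calc star w = (w * s) * star w := by rw [hws, one_mul]
      _ = w := by rw [mul_assoc, e, mul_one]
  have hwc : ∀ y, Commute s y → w * y = y * w := fun y hy => by
    have : w * (s * y) * w = w * (y * s) * w := by rw [hy.eq]
    calc w * y = w * (y * s) * w := by simp only [mul_assoc, hsw, mul_one]
      _ = w * (s * y) * w := by rw [hy.eq]
      _ = y * w := by rw [← mul_assoc w s, hws, one_mul]
  have hwv := hwc v hsv
  have hu1 : star (v * w) * (v * w) = 1 := by
    rw [star_mul, hwsa]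
    calc w * star v * (v * w) = w * (star v * v) * w := by simp only [mul_assoc]
      _ = (w * s) * (s * w) := by rw [h1, ← ht]; simp only [mul_assoc]
      _ = 1 := by rw [hws, hsw, one_mul]
  have hu2 : (v * w) * star (v * w) = 1 := by
    rw [← hwv, star_mul, hwsa]
    calc w * v * (star v * w) = w * (v * star v) * w := by simp only [mul_assoc]
      _ = (w * s) * (s * w) := by rw [h2, ← ht]; simp only [mul_assoc]
      _ = 1 := by rw [hws, hsw, one_mul]
  have humem : v * w ∈ unitary A := Unitary.mem_iff.2 ⟨hu1, hu2⟩
  have hus : (v * w) * s = v := by rw [mul_assoc, hws, mul_one]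
  have hup : (v * w) * p = q * (v * w) := by
    rw [mul_assoc, hwc p hsp, ← mul_assoc, hvp, mul_assoc]
  obtain ⟨u, hu⟩ : ∃ u, u = v * w := ⟨_, rfl⟩
  rw [← hu] at hu1 hu2 humem hus hup
  refine ⟨u, humem, by rw [hup, mul_assoc, hu2, mul_one], fun x hx => ?_⟩
  have hun : ‖u‖ = 1 := CStarRing.norm_of_mem_unitary humem
  have proj : ∀ r : A, r * r = r → star r = r → ‖r‖ ≤ 1 := fun r hr hr' => by
    have := CStarRing.norm_star_mul_self (x := r)
    rw [hr', hr] at this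
    nlinarith [norm_nonneg r]
  have hpn := proj p hp_idem hp_sa
  have hqn := proj q hq_idem hq_sa
  have hP := hpX x hx
  have hQ := hqX x hx
  have hP0 := norm_nonneg (p * x - x * p)
  have hQ0 := norm_nonneg (q * x - x * q)
  have mb : ∀ a b : A, ∀ α β : ℝ, ‖a‖ ≤ α → ‖b‖ ≤ β → ‖a * b‖ ≤ α * β := fun a b α β ha hb =>
    (norm_mul_le a b).trans (mul_le_mul ha hb (norm_nonneg _) ((norm_nonneg _).trans ha))
  -- commutator with d
  have hD : ‖d * x - x * d‖ ≤ ε := by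
    have e : d * x - x * d = (p - q) * ((p * x - x * p) - (q * x - x * q))
        + ((p * x - x * p) - (q * x - x * q)) * (p - q) := by
      rw [hd]; noncomm_ring
    have hc : ‖(p * x - x * p) - (q * x - x * q)‖ ≤ 2 * ε :=
      (norm_sub_le _ _).trans (by linarith)
    rw [e]
    have a1 := mb _ _ _ _ hpq.le hc
    have a2 := mb _ _ _ _ hc hpq.le
    exact (norm_add_le _ _).trans (by linarith)
  have hV : ‖v * x - x * v‖ ≤ 6 * ε := by
    obtain ⟨P, hP'⟩ : ∃ P, P = p * x - x * p := ⟨_, rfl⟩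
    obtain ⟨Q, hQ'⟩ : ∃ Q, Q = q * x - x * q := ⟨_, rfl⟩
    have e : v * x - x * v = (q * P + Q * p) + (q * P + Q * p) - P - Q := by
      rw [hv, hP', hQ']; noncomm_ring
    rw [← hP'] at hP
    rw [← hQ'] at hQ
    rw [e]
    have a1 := mb _ _ _ _ hqn hP.le
    have a2 := mb _ _ _ _ hQ.le hpn
    have a3 := norm_add_le (q * P) (Q * p)
    have a4 := norm_add_le (q * P + Q * p) (q * P + Q * p)
    have a5 := norm_sub_le (q * P + Q * p + (q * P + Q * p)) P
    exact (norm_sub_le _ _).trans (by linarith)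
  have hT : ‖t * x - x * t‖ ≤ ε := by
    have hdt : d = t + t - t * t := by
      have : d = 1 - s * s := by rw [ht]; abel
      rw [this, hs]; noncomm_ring
    obtain ⟨T, hT'⟩ : ∃ T, T = t * x - x * t := ⟨_, rfl⟩
    have e : T + T = (d * x - x * d) + (t * T + T * t) := by
      rw [hdt, hT']; noncomm_ring
    rw [← hT']
    have a0 : ‖T + T‖ = 2 * ‖T‖ := by rw [← two_smul ℝ T, norm_smul]; simp
    have a1 := mb t T _ _ htn le_rfl
    have a2 := mb T t _ _ le_rfl htn
    have a3 := norm_add_le (t * T) (T * t)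
    have a4 := norm_add_le (d * x - x * d) (t * T + T * t)
    rw [← e, a0] at a4
    linarith [norm_nonneg T]
  have e : u * x - x * u = (v * x - x * v) + u * (t * x - x * t) + (u * x - x * u) * t := by
    rw [← hus, hs]; noncomm_ring
  have a1 := mb u _ _ _ hun.le hT
  have a2 := mb (u * x - x * u) t _ _ le_rfl htn
  have a3 := norm_add_le (v * x - x * v + u * (t * x - x * t)) ((u * x - x * u) * t)
  have a4 := norm_add_le (v * x - x * v) (u * (t * x - x * t))
  rw [← e] at a3
  linarith
end

section
/- Let A be a unital C*-algebra, X a finite self-adjoint subset of the closed unit ball of A, and ε > 0. Let (p_t)_{t∈[0,1]} be a norm-continuous path of projections in A such that ‖p_t x − x p_t‖ < ε for all t ∈ [0,1] and all x ∈ X. Then there exist n ∈ ℕ and a unitary u ∈ M_{2n+1}(A) such that u (p_0 ⊕ 1_n ⊕ 0_n) u* = p_1 ⊕ 1_n ⊕ 0_n and ‖u·(x⊗1_{2n+1}) − (x⊗1_{2n+1})·u‖ < 4·10⁴·ε for all x ∈ X, where p ⊕ 1_n ⊕ 0_n denotes the diagonal matrix in M_{2n+1}(A) with diagonal entries (p,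 1, …, 1, 0, …, 0) (n ones and n zeros) and x⊗1_{2n+1} denotes the diagonal matrix with every diagonal entry equal to x. -/
noncomputable section

/-- The bounded operator on the Hilbert space `ℓ²(ι; H)` (finite `ι`) induced by a matrix of
bounded operators on `H`.  This realizes the unique C*-norm on matrices over `B(H)`. -/
def matOp {H : Type*} [NormedAddCommGroup H] [InnerProductSpace ℂ H]
    {ι : Type*} [Fintype ι] [DecidableEq ι]
    (m : Matrix ι ι (H →L[ℂ] H)) :
    (PiLp 2 fun _ : ι => H) →L[ℂ] (PiLp 2 fun _ : ι => H) :=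
  ((PiLp.continuousLinearEquiv 2 ℂ fun _ : ι => H).symm :
      ((_ : ι) → H) →L[ℂ] PiLp 2 fun _ : ι => H) ∘L
    (ContinuousLinearMap.pi fun i => ∑ j, (m i j) ∘L (ContinuousLinearMap.proj j)) ∘L
    ((PiLp.continuousLinearEquiv 2 ℂ fun _ : ι => H) :
      (PiLp 2 fun _ : ι => H) →L[ℂ] ((_ : ι) → H))

/-- The diagonal matrix `p ⊕ 1_n ⊕ 0_n` in `M_{2n+1}(A)`: first diagonal entry `p`,
then `n` ones, then `n` zeros. -/
def diagSum {A : Type*} [CStarAlgebra A] (p : A) (n : ℕ) :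
    Matrix (Fin (2 * n + 1)) (Fin (2 * n + 1)) A :=
  Matrix.diagonal fun i => if (i : ℕ) = 0 then p else if (i : ℕ) ≤ n then 1 else 0

/-- The diagonal amplification `x ⊗ 1` of `x` in a matrix algebra over `A`. -/
def ampl {A : Type*} [CStarAlgebra A] (x : A) (n : ℕ) :
    Matrix (Fin n) (Fin n) A :=
  Matrix.diagonal fun _ => x

lemma proj_norm_le {A : Type*} [CStarAlgebra A] {p : A} (h : p * p = p) (hs : star p = p) : ‖p‖ ≤ 1 := by
  have := CStarRing.norm_star_mul_self (x := p)
  rw [hs, h] at this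
  by_contra! hc
  nlinarith

lemma one_norm_le {A : Type*} [CStarAlgebra A] : ‖(1:A)‖ ≤ 1 := proj_norm_le (by simp) (by simp)

lemma close_proj {A : Type*} [CStarAlgebra A] {p q : A} (hp : p * p = p) (hps : star p = p)
    (hq : q * q = q) (hqs : star q = q) {δ : ℝ} (hδ : δ ≤ 1/2) (h : ‖p - q‖ ≤ δ) :
    ∃ v : A, star v * v = 1 ∧ v * star v = 1 ∧ v * p * star v = q ∧ ‖v - 1‖ ≤ 4 * δ := by
  have hδ0 : 0 ≤ δ := (norm_nonneg _).trans h
  set c : A := 1 - (p - q) * (p - q) with hc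
  set z : A := q * p + (1 - q) * (1 - p) with hz
  have hcs : IsSelfAdjoint c := by
    simp [IsSelfAdjoint, hc, hps, hqs]
  have hzs : star z = p * q + (1 - p) * (1 - q) := by simp [hz, hps, hqs]
  have hc' : c = 1 - p - q + p * q + q * p := by
    rw [hc]; simp only [sub_mul, mul_sub, hp, hq]; abel
  have hz' : z = 1 - p - q + q * p + q * p := by
    rw [hz]; simp only [sub_mul, mul_sub, mul_one, one_mul]; abel
  have hzs' : star z = 1 - p - q + p * q + p * q := by
    rw [hzs]; simp only [sub_mul, mul_sub, mul_one, one_mul]; abel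
  have e1 : p * (q * p) = p * q * p := by rw [mul_assoc]
  have hpp : ∀ a : A, p * (p * a) = p * a := fun a => by rw [← mul_assoc, hp]
  have hqq : ∀ a : A, q * (q * a) = q * a := fun a => by rw [← mul_assoc, hq]
  have hzz : star z * z = c := by
    rw [hzs', hz', hc']
    simp only [sub_mul, mul_sub, add_mul, mul_add, mul_one, one_mul, mul_assoc, hp, hq, hpp, hqq]; abel
  have hzz2 : z * star z = c := by
    rw [hzs', hz', hc']
    simp only [sub_mul, mul_sub, add_mul, mul_add, mul_one, one_mul, mul_assoc, hp, hq, hpp, hqq]; abel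
  have hzp : z * p = q * z := by
    rw [hz']
    simp only [sub_mul, mul_sub, add_mul, mul_add, mul_one, one_mul, mul_assoc, hp, hq, hpp, hqq]; abel
  have hcp : Commute c p := by
    rw [commute_iff_eq, hc']
    simp only [sub_mul, mul_sub, add_mul, mul_add, mul_one, one_mul, mul_assoc, hp, hq, hpp, hqq]; abel
  have hcq : Commute c q := by
    rw [commute_iff_eq, hc']
    simp only [sub_mul, mul_sub, add_mul, mul_add, mul_one, one_mul, mul_assoc, hp, hq, hpp, hqq]; abel
  have hz1 : ‖z - 1‖ ≤ 2 * δ := by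
    have : z - 1 = q * (p - q) + (q - p) * p := by
      rw [hz']; simp only [sub_mul, mul_sub, hp, hq]; abel
    rw [this]
    have h1 := proj_norm_le hp hps
    have h2 := proj_norm_le hq hqs
    have h3 := norm_mul_le q (p - q)
    have h4 := norm_mul_le (q - p) p
    rw [norm_sub_rev] at h4
    have h5 := norm_add_le (q * (p - q)) ((q - p) * p)
    nlinarith [norm_nonneg (p - q), norm_nonneg p, norm_nonneg q]
  have hsp : ∀ x ∈ spectrum ℝ c, |x - 1| ≤ δ ^ 2 := by
    intro x hx
    have h1 : x - 1 ∈ spectrum ℝ (c - algebraMap ℝ A 1) := by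
      rw [← spectrum.sub_singleton_eq]
      exact ⟨x, hx, 1, rfl, rfl⟩
    have h2 := spectrum.norm_le_norm_mul_of_mem h1
    rw [Real.norm_eq_abs] at h2
    have h3 : ‖c - algebraMap ℝ A 1‖ ≤ δ ^ 2 := by
      have : c - algebraMap ℝ A 1 = -((p - q) * (p - q)) := by rw [hc]; simp
      rw [this, norm_neg]
      refine (norm_mul_le _ _).trans ?_
      nlinarith [norm_nonneg (p - q)]
    calc _ ≤ _ := h2
      _ ≤ δ ^ 2 * 1 := by gcongr; exact one_norm_le
      _ = _ := mul_one _
  have hpos : ∀ x ∈ spectrum ℝ c, 3/4 ≤ x := by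
    intro x hx
    have := abs_le.1 (hsp x hx)
    nlinarith
  have hcont : ContinuousOn (fun x : ℝ => (√x)⁻¹) (spectrum ℝ c) := by
    apply ContinuousOn.inv₀ (by fun_prop)
    intro x hx
    have := hpos x hx
    positivity
  set b : A := cfc (fun x : ℝ => (√x)⁻¹) c with hb
  have hbs : star b = b := by
    have : IsSelfAdjoint b := cfc_predicate _ _
    exact this
  have hbc : b * b * c = 1 := by
    have hid : cfc (fun x : ℝ => x) c = c := cfc_id' ℝ c
    have e2 : b * b * c = b * b * cfc (fun x : ℝ => x) c := by rw [hid]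
    rw [e2, hb, ← cfc_mul _ _ c hcont hcont]
    rw [← cfc_mul (fun x : ℝ => (√x)⁻¹ * (√x)⁻¹) (fun x : ℝ => x) c (hcont.mul hcont) (by fun_prop)]
    rw [← cfc_one ℝ c]
    apply cfc_congr
    intro x hx
    have h1 := hpos x hx
    have h2 : √x ≠ 0 := by positivity
    have h3 : √x * √x = x := Real.mul_self_sqrt (by linarith)
    show (√x)⁻¹ * (√x)⁻¹ * x = 1
    rw [← mul_inv, h3]
    exact inv_mul_cancel₀ (by linarith)
  have hb1 : ‖b - 1‖ ≤ δ ^ 2 := by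
    rw [hb, ← cfc_one ℝ c, ← cfc_sub _ _ c hcont (by fun_prop)]
    apply norm_cfc_le (by positivity)
    intro x hx
    have h1 := hpos x hx
    refine le_trans ?_ (hsp x hx)
    have h3 : √x * √x = x := Real.mul_self_sqrt (by linarith)
    have h2 : 1/2 ≤ √x := by apply Real.le_sqrt_of_sq_le; linarith
    have : (√x)⁻¹ - 1 = (1 - x) * (√x + x)⁻¹ := by
      have : √x + x ≠ 0 := by positivity
      field_simp
      nlinarith
    show |(√x)⁻¹ - 1| ≤ _
    rw [this, abs_mul, abs_sub_comm 1 x]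
    apply mul_le_of_le_one_right (abs_nonneg _)
    rw [abs_of_nonneg (by positivity)]
    apply inv_le_one_of_one_le₀
    linarith
  have hbp : Commute b p := by
    rw [hb]; exact hcp.cfc_real _
  have hbq : Commute b q := by
    rw [hb]; exact hcq.cfc_real _
  have hbz : Commute b z := by
    rw [hz]
    exact (hbq.mul_right hbp).add_right
      (((Commute.one_right b).sub_right hbq).mul_right ((Commute.one_right b).sub_right hbp))
  have hbcc : Commute b c := by
    rw [hc]
    exact (Commute.one_right b).sub_right ((hbp.sub_right hbq).mul_right (hbp.sub_right hbq))
  refine ⟨z * b, ?_, ?_, ?_, ?_⟩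
  · rw [star_mul, hbs]
    calc b * star z * (z * b) = b * (star z * z) * b := by simp only [mul_assoc]
      _ = b * b * c := by rw [hzz, mul_assoc, ← hbcc.eq, mul_assoc]
      _ = 1 := hbc
  · rw [star_mul, hbs, ← hbz.eq]
    calc b * z * (b * star z) = b * (z * b) * star z := by simp only [mul_assoc]
      _ = b * b * (z * star z) := by rw [← hbz.eq]; simp only [mul_assoc]
      _ = 1 := by rw [hzz2, hbc]
  · rw [star_mul, hbs]
    calc z * b * p * (b * star z) = z * b * (p * b) * star z := by simp only [mul_assoc]
      _ = (z * b) * b * p * star z := by rw [← hbp.eq]; simp only [mul_assoc]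
      _ = b * b * (z * p) * star z := by
        rw [← hbz.eq, mul_assoc b z b, ← hbz.eq]; simp only [mul_assoc]
      _ = b * (b * q) * (z * star z) := by rw [hzp]; simp only [mul_assoc]
      _ = b * (q * b) * c := by rw [hzz2, hbq.eq]
      _ = b * q * (b * c) := by simp only [mul_assoc]
      _ = q * (b * b * c) := by rw [hbq.eq, mul_assoc, mul_assoc]
      _ = q := by rw [hbc, mul_one]
  · have e : z * b - 1 = (z - 1) * b + (b - 1) := by rw [sub_mul, one_mul]; abel
    have hbn : ‖b‖ ≤ 1 + δ ^ 2 := by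
      have := norm_add_le (b - 1) 1
      rw [sub_add_cancel] at this
      linarith [one_norm_le (A := A)]
    rw [e]
    refine (norm_add_le _ _).trans ?_
    have h1 := norm_mul_le (z - 1) b
    have h2 : ‖z - 1‖ * ‖b‖ ≤ 2 * δ * (1 + δ ^ 2) := by gcongr
    nlinarith [mul_nonneg hδ0 hδ0]

section mats
variable {A : Type*} [CStarAlgebra A] {H : Type*} [NormedAddCommGroup H] [InnerProductSpace ℂ H] [CompleteSpace H]
  {I : Type*} [Fintype I] [DecidableEq I]

lemma matOp_apply (m : Matrix I I (H →L[ℂ] H)) (y : PiLp 2 fun _ : I => H) (i : I) :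
    matOp m y i = ∑ j, m i j (y j) := by
  simp [matOp]

lemma matOp_mul (m m' : Matrix I I (H →L[ℂ] H)) : matOp (m * m') = matOp m * matOp m' := by
  ext y i
  simp only [ContinuousLinearMap.mul_apply, matOp_apply, Matrix.mul_apply, map_sum, ContinuousLinearMap.sum_apply]
  rw [Finset.sum_comm]

lemma matOp_add (m m' : Matrix I I (H →L[ℂ] H)) : matOp (m + m') = matOp m + matOp m' := by
  ext y i
  simp [matOp_apply, Finset.sum_add_distrib]

lemma matOp_diag (f : I → (H →L[ℂ] H)) {C : ℝ} (hC : 0 ≤ C) (hf : ∀ i, ‖f i‖ ≤ C) :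
    ‖matOp (Matrix.diagonal f)‖ ≤ C := by
  refine ContinuousLinearMap.opNorm_le_bound _ hC fun y => ?_
  have h0 : ∀ i, matOp (Matrix.diagonal f) y i = f i (y i) := by
    intro i
    rw [matOp_apply, Finset.sum_eq_single i] <;> simp +contextual [Matrix.diagonal_apply, eq_comm]
  refine (sq_le_sq₀ (by positivity) (by positivity)).1 ?_
  rw [mul_pow, PiLp.norm_sq_eq_of_L2, PiLp.norm_sq_eq_of_L2, Finset.mul_sum]
  refine Finset.sum_le_sum fun i _ => ?_
  rw [h0, ← mul_pow]
  have := (f i).le_of_opNorm_le (hf i) (y i)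
  gcongr

/-- permutation matrix -/
def pmat (R : Type*) [Zero R] [One R] (σ : I ≃ I) : Matrix I I R :=
  Matrix.of fun i j => if σ i = j then 1 else 0

lemma matOp_pmat (σ : I ≃ I) : ‖matOp (pmat (H →L[ℂ] H) σ)‖ ≤ 1 := by
  refine ContinuousLinearMap.opNorm_le_bound _ zero_le_one fun y => ?_
  have h0 : ∀ i, matOp (pmat (H →L[ℂ] H) σ) y i = y (σ i) := by
    intro i
    rw [matOp_apply, Finset.sum_eq_single (σ i)] <;> simp +contextual [pmat, eq_comm]
  refine (sq_le_sq₀ (by positivity) (by positivity)).1 ?_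
  rw [one_mul, PiLp.norm_sq_eq_of_L2, PiLp.norm_sq_eq_of_L2]
  simp only [h0]
  exact (Equiv.sum_comp σ (fun i => ‖y i‖ ^ 2)).le

lemma pmat_diag (σ : I ≃ I) (f : I → A) :
    pmat A σ * Matrix.diagonal f = Matrix.diagonal (f ∘ σ) * pmat A σ := by
  ext i j
  simp only [Matrix.mul_diagonal, Matrix.diagonal_mul, pmat, Matrix.of_apply, Function.comp]
  split_ifs with h <;> simp [h]

lemma pmat_mul (σ τ : I ≃ I) : pmat A σ * pmat A τ = pmat A (σ.trans τ) := by
  ext i j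
  rw [Matrix.mul_apply, Finset.sum_eq_single (σ i)] <;> simp +contextual [pmat, eq_comm]

lemma pmat_refl : pmat A (Equiv.refl I) = 1 := by
  ext i j
  by_cases h : i = j <;> simp [pmat, Matrix.one_apply, h]

lemma pmat_star (σ : I ≃ I) : star (pmat A σ) = pmat A σ.symm := by
  ext i j
  simp only [Matrix.star_apply, pmat, Matrix.of_apply, Equiv.symm_apply_eq, apply_ite star, star_one, star_zero]
  simp only [eq_comm]

lemma diag_star (f : I → A) : star (Matrix.diagonal f) = Matrix.diagonal (fun i => star (f i)) := by
  rw [Matrix.star_eq_conjTranspose, Matrix.diagonal_conjTranspose]; rfl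

/-- norm -/
def Nm (ι₀ : A →⋆ₐ[ℂ] (H →L[ℂ] H)) (m : Matrix I I A) : ℝ := ‖matOp (m.map ι₀)‖

variable (ι₀ : A →⋆ₐ[ℂ] (H →L[ℂ] H))

lemma Nm_nonneg (m : Matrix I I A) : 0 ≤ Nm ι₀ m := norm_nonneg _

lemma Nm_mul (m m' : Matrix I I A) : Nm ι₀ (m * m') ≤ Nm ι₀ m * Nm ι₀ m' := by
  unfold Nm
  have : (m * m').map ι₀ = m.map ι₀ * m'.map ι₀ := Matrix.map_mul (f := (ι₀ : A →+* (H →L[ℂ] H)))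
  rw [this, matOp_mul]
  exact norm_mul_le _ _

lemma Nm_add (m m' : Matrix I I A) : Nm ι₀ (m + m') ≤ Nm ι₀ m + Nm ι₀ m' := by
  unfold Nm
  rw [Matrix.map_add _ (map_add ι₀), matOp_add]
  exact norm_add_le _ _

lemma Nm_diag (hι₀ : Isometry ι₀) (f : I → A) {C : ℝ} (hC : 0 ≤ C) (hf : ∀ i, ‖f i‖ ≤ C) :
    Nm ι₀ (Matrix.diagonal f) ≤ C := by
  unfold Nm
  rw [Matrix.diagonal_map (map_zero ι₀)]
  refine matOp_diag _ hC fun i => ?_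
  have := hι₀.norm_map_of_map_zero (map_zero ι₀) (f i)
  exact this.le.trans (hf i)

lemma Nm_pmat (σ : I ≃ I) : Nm ι₀ (pmat A σ) ≤ 1 := by
  unfold Nm
  have : (pmat A σ).map ι₀ = pmat (H →L[ℂ] H) σ := by
    ext1 i j
    simp only [Matrix.map_apply, pmat, Matrix.of_apply]
    split_ifs <;> simp
  rw [this]
  exact matOp_pmat σ

/-- rotation -/
def Wm (τ : I ≃ I) (q : I → A) : Matrix I I A :=
  Matrix.diagonal (fun i => 1 - q i) + Matrix.diagonal q * pmat A τ

variable {τ : I ≃ I} {q : I → A}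

lemma Wm_star (hτ : τ.symm = τ) (hq : ∀ i, star (q i) = q i) (hqτ : ∀ i, q (τ i) = q i) :
    star (Wm τ q) = Wm τ q := by
  rw [Wm, star_add, star_mul, diag_star, diag_star, pmat_star, hτ, pmat_diag]
  have : (fun i => star (q i)) ∘ τ = q := by ext i; simp [hq, hqτ]
  rw [this]; simp [hq]

lemma Wm_conj (hτ : τ.symm = τ) (hq : ∀ i, q i * q i = q i) (hqτ : ∀ i, q (τ i) = q i)
    (f : I → A) (h1 : ∀ i, q i * f i = f i * q i) (h2 : ∀ i, q i * f (τ i) = f (τ i) * q i) :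
    Wm τ q * Matrix.diagonal f * Wm τ q =
      Matrix.diagonal (fun i => (1 - q i) * f i + q i * f (τ i)) := by
  have hτ2 : τ.trans τ = Equiv.refl I := by
    conv_lhs => enter [1]; rw [← hτ]
    simp
  have c1 : q ∘ τ = q := by ext i; simp [hqτ]
  have c2 : (fun i => 1 - q i) ∘ τ = (fun i => 1 - q i) := by ext i; simp [hqτ]
  have key : Wm τ q * Matrix.diagonal f * Wm τ q =
      Matrix.diagonal (fun i => (1 - q i) * f i * (1 - q i) + q i * f (τ i) * q i) +
      Matrix.diagonal (fun i => (1 - q i) * f i * q i + q i * f (τ i) * (1 - q i)) * pmat A τ := by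
    simp only [Wm, add_mul, mul_add]
    have e1 : Matrix.diagonal q * pmat A τ * Matrix.diagonal f * Matrix.diagonal (fun i => 1 - q i)
      = Matrix.diagonal (fun i => q i * f (τ i) * (1 - q i)) * pmat A τ := by
      rw [mul_assoc (Matrix.diagonal q), pmat_diag, mul_assoc, mul_assoc, pmat_diag, c2]
      simp only [← mul_assoc, Matrix.diagonal_mul_diagonal, Function.comp]
    have e2 : Matrix.diagonal q * pmat A τ * Matrix.diagonal f * (Matrix.diagonal q * pmat A τ)
      = Matrix.diagonal (fun i => q i * f (τ i) * q i) := by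
      rw [mul_assoc (Matrix.diagonal q), pmat_diag, mul_assoc, mul_assoc, ← mul_assoc (pmat A τ), pmat_diag, c1,
        mul_assoc, pmat_mul, hτ2, pmat_refl, mul_one]
      simp only [← mul_assoc, Matrix.diagonal_mul_diagonal, Function.comp]
    rw [e1, e2, ← mul_assoc, Matrix.diagonal_mul_diagonal, Matrix.diagonal_mul_diagonal, Matrix.diagonal_mul_diagonal,
      ← Matrix.diagonal_add, ← Matrix.diagonal_add, add_mul]
    abel
  have k1 : ∀ i, (1 - q i) * f i * q i + q i * f (τ i) * (1 - q i) = 0 := by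
    intro i
    rw [mul_assoc, ← h1, ← mul_assoc, sub_mul, hq, h2, mul_assoc, mul_sub, hq]; simp
  have k2 : ∀ i, (1 - q i) * f i * (1 - q i) + q i * f (τ i) * q i = (1 - q i) * f i + q i * f (τ i) := by
    intro i
    rw [mul_assoc (q i), ← h2, ← mul_assoc (q i), hq, mul_sub, mul_assoc _ _ (q i), ← h1, ← mul_assoc _ (q i), sub_mul 1 _ (q i), hq]; simp
  rw [key]
  simp only [k1, k2]
  simp

lemma Wm_sq (hτ : τ.symm = τ) (hq : ∀ i, q i * q i = q i) (hqτ : ∀ i, q (τ i) = q i) :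
    Wm τ q * Wm τ q = 1 := by
  have := Wm_conj hτ hq hqτ (fun _ => 1) (by simp) (by simp)
  simpa using this

lemma Wm_norm (hι₀ : Isometry ι₀) (hq : ∀ i, q i * q i = q i) (hqs : ∀ i, star (q i) = q i) :
    Nm ι₀ (Wm τ q) ≤ 2 := by
  refine (Nm_add _ _ _).trans ?_
  have h1 : Nm ι₀ (Matrix.diagonal (fun i => 1 - q i)) ≤ 1 := by
    apply Nm_diag _ hι₀ _ zero_le_one
    intro i
    apply proj_norm_le
    · simp [mul_sub, sub_mul, hq]
    · simp [hqs]
  have h2 : Nm ι₀ (Matrix.diagonal q) ≤ 1 :=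
    Nm_diag _ hι₀ _ zero_le_one fun i => proj_norm_le (hq i) (hqs i)
  have h3 := Nm_mul ι₀ (Matrix.diagonal q) (pmat A τ)
  have h4 := Nm_pmat ι₀ τ
  nlinarith [Nm_nonneg ι₀ (Matrix.diagonal q), Nm_nonneg ι₀ (pmat A τ)]

lemma Wm_comm (hι₀ : Isometry ι₀) (x : A) {ε : ℝ} (hε : 0 ≤ ε) (h : ∀ i, ‖q i * x - x * q i‖ ≤ ε) :
    Nm ι₀ (Wm τ q * Matrix.diagonal (fun _ => x) - Matrix.diagonal (fun _ => x) * Wm τ q) ≤ 2 * ε := by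
  have e : Wm τ q * Matrix.diagonal (fun _ => x) - Matrix.diagonal (fun _ => x) * Wm τ q =
    Matrix.diagonal (fun i => x * q i - q i * x) + Matrix.diagonal (fun i => q i * x - x * q i) * pmat A τ := by
    simp only [Wm, add_mul, mul_add]
    rw [mul_assoc, pmat_diag, ← mul_assoc, ← mul_assoc]
    simp only [Matrix.diagonal_mul_diagonal, Function.comp]
    rw [add_sub_add_comm, ← sub_mul, Matrix.diagonal_sub, Matrix.diagonal_sub]
    congr 2
    ext i
    simp [sub_mul, mul_sub]
  rw [e]
  refine (Nm_add _ _ _).trans ?_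
  have h1 : Nm ι₀ (Matrix.diagonal (fun i => x * q i - q i * x)) ≤ ε :=
    Nm_diag _ hι₀ _ hε fun i => by rw [norm_sub_rev]; exact h i
  have h2 : Nm ι₀ (Matrix.diagonal (fun i => q i * x - x * q i)) ≤ ε := Nm_diag _ hι₀ _ hε h
  have h3 := Nm_mul ι₀ (Matrix.diagonal (fun i => q i * x - x * q i)) (pmat A τ)
  have h4 := Nm_pmat ι₀ τ
  have := mul_le_mul h2 h4 (Nm_nonneg _ _) hε
  linarith
end mats

section perms

/-- swap -/
def tauF (n : ℕ) (i : Fin (2 * n + 1)) : Fin (2 * n + 1) :=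
  ⟨if (i : ℕ) = 0 then 0 else if (i : ℕ) ≤ n then i + n else i - n, by
    have := i.2; split_ifs <;> omega⟩

lemma tauF_inv (n : ℕ) : Function.Involutive (tauF n) := by
  intro i
  have := i.2
  apply Fin.ext
  simp only [tauF]
  split_ifs <;> omega

/-- swap as a permutation -/
def tauP (n : ℕ) : Fin (2 * n + 1) ≃ Fin (2 * n + 1) := (tauF_inv n).toPerm

lemma tauP_val (n : ℕ) (i : Fin (2 * n + 1)) :
    (tauP n i : ℕ) = if (i : ℕ) = 0 then 0 else if (i : ℕ) ≤ n then i + n else i - n := rfl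

lemma tauP_symm (n : ℕ) : (tauP n).symm = tauP n := (tauF_inv n).toPerm_symm

/-- shift -/
def sigP (n : ℕ) (hn : 1 ≤ n) : Fin (2 * n + 1) ≃ Fin (2 * n + 1) where
  toFun i := ⟨if (i : ℕ) = 0 then 2 * n else if (i : ℕ) ≤ n then i else if (i : ℕ) = n + 1 then 0 else i - 1, by
    have := i.2; split_ifs <;> omega⟩
  invFun i := ⟨if (i : ℕ) = 0 then n + 1 else if (i : ℕ) ≤ n then i else if (i : ℕ) = 2 * n then 0 else i + 1, by
    have := i.2; split_ifs <;> omega⟩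
  left_inv i := by
    have := i.2
    apply Fin.ext
    dsimp only
    grind
  right_inv i := by
    have := i.2
    apply Fin.ext
    dsimp only
    grind

lemma sigP_val (n : ℕ) (hn : 1 ≤ n) (i : Fin (2 * n + 1)) :
    (sigP n hn i : ℕ) =
    if (i : ℕ) = 0 then 2 * n else if (i : ℕ) ≤ n then i else if (i : ℕ) = n + 1 then 0 else i - 1 := rfl

end perms

section core
variable {A : Type*} [CStarAlgebra A]

/-- first family -/
def qA (n : ℕ) (P : ℕ → A) (i : Fin (2 * n + 1)) : A :=
  if (i : ℕ) = 0 then 0 else if (i : ℕ) ≤ n then P i else P (i - n)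

/-- second family -/
def qB (n : ℕ) (P : ℕ → A) (i : Fin (2 * n + 1)) : A :=
  if (i : ℕ) = 0 then 0 else if (i : ℕ) ≤ n then P (i - 1) else P (i - n - 1)

/-- unitaries -/
def vV (n : ℕ) (v : ℕ → A) (i : Fin (2 * n + 1)) : A :=
  if (i : ℕ) = 0 then 1 else if (i : ℕ) ≤ n then v (i - 1) else 1

lemma qA_cases {n : ℕ} {P : ℕ → A} (Q : A → Prop) (h0 : Q 0) (h : ∀ k, Q (P k)) (i) : Q (qA n P i) := by
  unfold qA; split_ifs <;> simp [h0, h]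

lemma qB_cases {n : ℕ} {P : ℕ → A} (Q : A → Prop) (h0 : Q 0) (h : ∀ k, Q (P k)) (i) : Q (qB n P i) := by
  unfold qB; split_ifs <;> simp [h0, h]

lemma vV_cases {n : ℕ} {P : ℕ → A} (Q : A → Prop) (h0 : Q 1) (h : ∀ k, Q (P k)) (i) : Q (vV n P i) := by
  unfold vV; split_ifs <;> simp [h0, h]

lemma qA_tau {n : ℕ} {P : ℕ → A} (i) : qA n P (tauP n i) = qA n P i := by
  have := i.2
  simp only [qA, tauP_val]
  split_ifs <;> first | rfl | omega | (congr 1; omega)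

lemma qB_tau {n : ℕ} {P : ℕ → A} (i) : qB n P (tauP n i) = qB n P i := by
  have := i.2
  simp only [qB, tauP_val]
  split_ifs <;> first | rfl | omega | (congr 1; omega)

/-- intermediate diagonal -/
def gA (n : ℕ) (P : ℕ → A) (i : Fin (2 * n + 1)) : A :=
  if (i : ℕ) = 0 then P 0 else if (i : ℕ) ≤ n then 1 - P i else P (i - n)

/-- intermediate diagonal -/
def gA' (n : ℕ) (P : ℕ → A) (i : Fin (2 * n + 1)) : A :=
  if (i : ℕ) = 0 then P 0 else if (i : ℕ) ≤ n then 1 - P (i - 1) else P (i - n)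

/-- intermediate diagonal -/
def gB (n : ℕ) (P : ℕ → A) (i : Fin (2 * n + 1)) : A :=
  if (i : ℕ) = 0 then P n else if (i : ℕ) ≤ n then 1 - P (i - 1) else P (i - n - 1)

/-- intertwiner -/
def uU (n : ℕ) (hn : 1 ≤ n) (P v : ℕ → A) : Matrix (Fin (2 * n + 1)) (Fin (2 * n + 1)) A :=
  Wm (tauP n) (qB n P) * (pmat A (sigP n hn) * Matrix.diagonal (vV n v)) * Wm (tauP n) (qA n P)

variable {n : ℕ} (hn : 1 ≤ n) {P v : ℕ → A} (hP : ∀ k, P k * P k = P k) (hPs : ∀ k, star (P k) = P k)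
  (hv1 : ∀ k, star (v k) * v k = 1) (hv2 : ∀ k, v k * star (v k) = 1)

include hP in
lemma step1 : Wm (tauP n) (qA n P) * diagSum (P 0) n * Wm (tauP n) (qA n P) = Matrix.diagonal (gA n P) := by
  unfold diagSum
  rw [Wm_conj (tauP_symm n) (qA_cases (fun a => a * a = a) (by simp) hP) qA_tau]
  · congr 1
    ext i
    have := i.2
    simp only [qA, gA, tauP_val]
    split_ifs <;> first | omega | simp
  · intro i
    simp only [qA]
    split_ifs <;> simp
  · intro i
    simp only [qA, tauP_val]
    split_ifs <;> first | omega | simp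

include hP in
lemma step3 : Wm (tauP n) (qB n P) * Matrix.diagonal (gB n P) * Wm (tauP n) (qB n P) = diagSum (P n) n := by
  unfold diagSum
  rw [Wm_conj (tauP_symm n) (qB_cases (fun a => a * a = a) (by simp) hP) qB_tau]
  · congr 1
    ext i
    have := i.2
    simp only [qB, gB, tauP_val]
    split_ifs <;> first | omega | simp [mul_sub, sub_mul, hP, Nat.add_sub_cancel]
  · intro i
    simp only [qB, gB]
    split_ifs <;> simp [mul_sub, sub_mul]
  · intro i
    simp only [qB, gB, tauP_val]
    split_ifs <;> first | omega | simp [mul_sub, sub_mul]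

include hv2 in
lemma step2 (hv : ∀ k, v k * P (k + 1) * star (v k) = P k) :
    (pmat A (sigP n hn) * Matrix.diagonal (vV n v)) * Matrix.diagonal (gA n P) *
      star (pmat A (sigP n hn) * Matrix.diagonal (vV n v)) = Matrix.diagonal (gB n P) := by
  have e1 : Matrix.diagonal (vV n v) * Matrix.diagonal (gA n P) * star (Matrix.diagonal (vV n v))
      = Matrix.diagonal (gA' n P) := by
    rw [diag_star, Matrix.diagonal_mul_diagonal, Matrix.diagonal_mul_diagonal]
    congr 1
    ext i
    simp only [vV, gA, gA']
    split_ifs with h1 h2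
    · simp
    · have := hv (i - 1)
      rw [Nat.sub_add_cancel (by omega)] at this
      rw [mul_sub, sub_mul, this, mul_one, hv2]
    · simp
  calc _ = pmat A (sigP n hn) * (Matrix.diagonal (vV n v) * Matrix.diagonal (gA n P) * star (Matrix.diagonal (vV n v)))
        * star (pmat A (sigP n hn)) := by rw [star_mul]; simp only [mul_assoc]
    _ = Matrix.diagonal (gA' n P ∘ sigP n hn) := by
      rw [e1, pmat_diag, pmat_star, mul_assoc, pmat_mul, Equiv.self_trans_symm, pmat_refl, mul_one]
    _ = _ := by
      congr 1
      ext i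
      have := i.2
      simp only [gA', gB, Function.comp, sigP_val]
      split_ifs <;> first | omega | rfl | (congr 1; omega)

include hP hPs hv1 hv2 in
lemma uU_props (hv : ∀ k, v k * P (k + 1) * star (v k) = P k) :
    star (uU n hn P v) * uU n hn P v = 1 ∧ uU n hn P v * star (uU n hn P v) = 1 ∧
    uU n hn P v * diagSum (P 0) n * star (uU n hn P v) = diagSum (P n) n := by
  set W1 := Wm (tauP n) (qA n P) with hW1
  set W2 := Wm (tauP n) (qB n P) with hW2
  set S := pmat A (sigP n hn) * Matrix.diagonal (vV n v) with hS
  have a1 : star W1 = W1 := Wm_star (tauP_symm n) (qA_cases (fun a => star a = a) (by simp) hPs) qA_tau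
  have a2 : star W2 = W2 := Wm_star (tauP_symm n) (qB_cases (fun a => star a = a) (by simp) hPs) qB_tau
  have b1 : W1 * W1 = 1 := Wm_sq (tauP_symm n) (qA_cases (fun a => a * a = a) (by simp) hP) qA_tau
  have b2 : W2 * W2 = 1 := Wm_sq (tauP_symm n) (qB_cases (fun a => a * a = a) (by simp) hP) qB_tau
  have V1 : star (Matrix.diagonal (vV n v)) * Matrix.diagonal (vV n v) = 1 := by
    rw [diag_star, Matrix.diagonal_mul_diagonal, ← Matrix.diagonal_one]
    congr 1
    ext i
    exact vV_cases (fun a => star a * a = 1) (by simp) hv1 i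
  have V2 : Matrix.diagonal (vV n v) * star (Matrix.diagonal (vV n v)) = 1 := by
    rw [diag_star, Matrix.diagonal_mul_diagonal, ← Matrix.diagonal_one]
    congr 1
    ext i
    exact vV_cases (fun a => a * star a = 1) (by simp) hv2 i
  have S1 : star S * S = 1 := by
    rw [hS, star_mul, mul_assoc, ← mul_assoc (star (pmat A _)), pmat_star, pmat_mul, Equiv.symm_trans_self,
      pmat_refl, one_mul, V1]
  have S2 : S * star S = 1 := by
    rw [hS, star_mul, mul_assoc, ← mul_assoc (Matrix.diagonal _), V2, one_mul, pmat_star, pmat_mul,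
      Equiv.self_trans_symm, pmat_refl]
  have su : star (uU n hn P v) = W1 * star S * W2 := by
    simp only [uU, star_mul, mul_assoc, ← hW1, ← hW2, a1, a2, hS]
  have hu : uU n hn P v = W2 * S * W1 := rfl
  rw [su, hu]
  refine ⟨?_, ?_, ?_⟩
  · calc W1 * star S * W2 * (W2 * S * W1) = W1 * (star S * (W2 * W2) * S) * W1 := by simp only [mul_assoc]
      _ = 1 := by rw [b2, mul_one, S1, mul_one, b1]
  · calc W2 * S * W1 * (W1 * star S * W2) = W2 * (S * (W1 * W1) * star S) * W2 := by simp only [mul_assoc]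
      _ = 1 := by rw [b1, mul_one, S2, mul_one, b2]
  · calc W2 * S * W1 * diagSum (P 0) n * (W1 * star S * W2)
        = W2 * (S * (W1 * diagSum (P 0) n * W1) * star S) * W2 := by simp only [mul_assoc]
      _ = _ := by rw [hW1, step1 hP, hS, step2 hn hv2 hv, hW2, step3 hP]

include hP hPs in
lemma uU_comm {H : Type*} [NormedAddCommGroup H] [InnerProductSpace ℂ H] [CompleteSpace H]
    (ι₀ : A →⋆ₐ[ℂ] (H →L[ℂ] H)) (hι₀ : Isometry ι₀) {ε : ℝ} (hε : 0 ≤ ε)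
    (x : A) (hx : ‖x‖ ≤ 1) (hxP : ∀ k, ‖P k * x - x * P k‖ ≤ ε) (hv1 : ∀ k, star (v k) * v k = 1)
    (hvn : ∀ k, ‖v k - 1‖ ≤ ε) :
    Nm ι₀ (uU n hn P v * ampl x (2 * n + 1) - ampl x (2 * n + 1) * uU n hn P v) ≤ 16 * ε := by
  set W1 := Wm (tauP n) (qA n P) with hW1
  set W2 := Wm (tauP n) (qB n P) with hW2
  set S := pmat A (sigP n hn) with hS
  set V := Matrix.diagonal (vV n v) with hV
  set D := ampl x (2 * n + 1) with hD
  have c1 : Nm ι₀ (W1 * D - D * W1) ≤ 2 * ε :=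
    Wm_comm ι₀ hι₀ x hε (qA_cases (fun a => ‖a * x - x * a‖ ≤ ε) (by simpa) hxP)
  have c2 : Nm ι₀ (W2 * D - D * W2) ≤ 2 * ε :=
    Wm_comm ι₀ hι₀ x hε (qB_cases (fun a => ‖a * x - x * a‖ ≤ ε) (by simpa) hxP)
  have n1 : Nm ι₀ W1 ≤ 2 := Wm_norm ι₀ hι₀ (qA_cases (fun a => a * a = a) (by simp) hP)
    (qA_cases (fun a => star a = a) (by simp) hPs)
  have n2 : Nm ι₀ W2 ≤ 2 := Wm_norm ι₀ hι₀ (qB_cases (fun a => a * a = a) (by simp) hP)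
    (qB_cases (fun a => star a = a) (by simp) hPs)
  have nS : Nm ι₀ S ≤ 1 := Nm_pmat ι₀ _
  have nV : Nm ι₀ V ≤ 1 := by
    refine Nm_diag ι₀ hι₀ _ zero_le_one (vV_cases (fun a => ‖a‖ ≤ 1) one_norm_le fun k => ?_)
    have h1 := CStarRing.norm_star_mul_self (x := v k)
    rw [hv1] at h1
    have h2 := one_norm_le (A := A)
    by_contra! hc
    nlinarith
  have cV : Nm ι₀ (V * D - D * V) ≤ 2 * ε := by
    have : V * D - D * V = Matrix.diagonal (fun i => vV n v i * x - x * vV n v i) := by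
      rw [hV, hD, ampl, Matrix.diagonal_mul_diagonal, Matrix.diagonal_mul_diagonal, Matrix.diagonal_sub]
    rw [this]
    refine Nm_diag ι₀ hι₀ _ (by positivity) (vV_cases (fun a => ‖a * x - x * a‖ ≤ 2 * ε) (by simpa) fun k => ?_)
    have e : v k * x - x * v k = (v k - 1) * x - x * (v k - 1) := by
      simp only [sub_mul, mul_sub, mul_one, one_mul]; abel
    rw [e]
    have h1 := norm_sub_le ((v k - 1) * x) (x * (v k - 1))
    have h2 := norm_mul_le (v k - 1) x
    have h3 := norm_mul_le x (v k - 1)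
    have h4 := hvn k
    nlinarith [norm_nonneg x, norm_nonneg (v k - 1)]
  have cS : S * D = D * S := by
    rw [hD, ampl, hS, pmat_diag]; rfl
  have e : uU n hn P v * D - D * uU n hn P v =
      W2 * S * V * (W1 * D - D * W1) + W2 * S * (V * D - D * V) * W1 + (W2 * D - D * W2) * S * V * W1 := by
    have hu : uU n hn P v = W2 * (S * V) * W1 := rfl
    have e2 : W2 * S * (D * V) * W1 = W2 * D * S * V * W1 := by
      rw [← mul_assoc (W2 * S), mul_assoc W2 S D, cS]; simp only [mul_assoc]
    rw [hu]
    have e3 : W2 * S * (V * D - D * V) * W1 = W2 * S * (V * D) * W1 - W2 * D * S * V * W1 := by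
      rw [mul_sub, sub_mul, e2]
    rw [e3]
    simp only [mul_sub, sub_mul, mul_assoc]
    abel
  rw [e]
  have pr : ∀ {a b : Matrix (Fin (2 * n + 1)) (Fin (2 * n + 1)) A} {r s : ℝ}, Nm ι₀ a ≤ r → Nm ι₀ b ≤ s →
      Nm ι₀ (a * b) ≤ r * s := fun {a b r s} h1 h2 =>
    (Nm_mul ι₀ a b).trans (mul_le_mul h1 h2 (Nm_nonneg _ _) ((Nm_nonneg _ _).trans h1))
  have t1 := pr (pr (pr n2 nS) nV) c1
  have t2 := pr (pr (pr n2 nS) cV) n1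
  have t3 := pr (pr (pr c2 nS) nV) n1
  refine (Nm_add _ _ _).trans ?_
  have := Nm_add ι₀ (W2 * S * V * (W1 * D - D * W1)) (W2 * S * (V * D - D * V) * W1)
  linarith

end core

/-- Let `A` be a unital C*-algebra (realized isometrically inside some
`B(H)` via `ι₀`, which is how the C*-norm on matrix algebras over `A` is expressed), `X` a
finite self-adjoint subset of the closed unit ball of `A`, and `ε > 0`.  If `(p_t)_{t∈[0,1]}`
is a norm-continuous path of projections with `‖p_t x − x p_t‖ < ε` for all `t` and `x ∈ X`,
then there are `n ∈ ℕ` and a unitary `u ∈ M_{2n+1}(A)` conjugating `p₀ ⊕ 1_n ⊕ 0_n` to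
`p₁ ⊕ 1_n ⊕ 0_n`, with `‖u(x⊗1) − (x⊗1)u‖ < 4·10⁴·ε` for all `x ∈ X`. -/
theorem statement10 {A : Type*} [CStarAlgebra A]
    {H : Type*} [NormedAddCommGroup H] [InnerProductSpace ℂ H] [CompleteSpace H]
    (ι₀ : A →⋆ₐ[ℂ] (H →L[ℂ] H)) (hι₀ : Isometry ι₀)
    (X : Set A) (hXfin : X.Finite) (hXsa : ∀ x ∈ X, star x ∈ X)
    (hXball : ∀ x ∈ X, ‖x‖ ≤ 1) (ε : ℝ) (hε : 0 < ε)
    (p : ℝ → A) (hp_cont : ContinuousOn p (Set.Icc 0 1))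
    (hp_proj : ∀ t ∈ Set.Icc (0 : ℝ) 1, p t * p t = p t ∧ star (p t) = p t)
    (hp_comm : ∀ t ∈ Set.Icc (0 : ℝ) 1, ∀ x ∈ X, ‖p t * x - x * p t‖ < ε) :
    ∃ (n : ℕ) (u : Matrix (Fin (2 * n + 1)) (Fin (2 * n + 1)) A),
      star u * u = 1 ∧ u * star u = 1 ∧
      u * diagSum (p 0) n * star u = diagSum (p 1) n ∧
      ∀ x ∈ X,
        ‖matOp (((u * ampl x (2 * n + 1) - ampl x (2 * n + 1) * u)).map ι₀)‖ <
          4 * 10 ^ 4 * ε := by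
  set δ : ℝ := min (1 / 2) (ε / 4) with hδ
  have hδ0 : 0 < δ := by positivity
  obtain ⟨η, hη, hu⟩ := Metric.uniformContinuousOn_iff.1
    (isCompact_Icc.uniformContinuousOn_of_continuous hp_cont) δ hδ0
  obtain ⟨m, hm⟩ := exists_nat_one_div_lt hη
  set n := m + 1 with hn
  set s : ℕ → ℝ := fun k => min ((k : ℝ) / n) 1 with hs
  have hn0 : (0 : ℝ) < n := by positivity
  have hsI : ∀ k, s k ∈ Set.Icc (0 : ℝ) 1 := fun k => ⟨by positivity, min_le_right _ _⟩
  have hss : ∀ k, dist (s (k + 1)) (s k) < η := by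
    intro k
    refine lt_of_le_of_lt ?_ hm
    rw [Real.dist_eq]
    refine (abs_min_sub_min_le_max _ _ _ _).trans ?_
    have : ((k + 1 : ℕ) : ℝ) / n - k / n = 1 / n := by push_cast; ring
    rw [this, sub_self, abs_zero, abs_of_pos (by positivity), max_eq_left (by positivity), hn]
    push_cast
    rfl
  set P : ℕ → A := fun k => p (s k) with hPdef
  have hP : ∀ k, P k * P k = P k := fun k => (hp_proj _ (hsI k)).1
  have hPs : ∀ k, star (P k) = P k := fun k => (hp_proj _ (hsI k)).2
  have hv : ∀ k, ∃ v : A, star v * v = 1 ∧ v * star v = 1 ∧ v * P (k + 1) * star v = P k ∧ ‖v - 1‖ ≤ 4 * δ := by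
    intro k
    refine close_proj (hP _) (hPs _) (hP _) (hPs _) (min_le_left _ _) ?_
    have := hu _ (hsI (k + 1)) _ (hsI k) (hss k)
    rw [dist_eq_norm] at this
    exact this.le
  choose v hv1 hv2 hv3 hv4 using hv
  have P0 : P 0 = p 0 := by simp [hPdef, hs]
  have Pn : P n = p 1 := by simp [hPdef, hs, div_self hn0.ne']
  have hn1 : 1 ≤ n := by omega
  obtain ⟨r1, r2, r3⟩ := uU_props hn1 hP hPs hv1 hv2 hv3
  rw [P0, Pn] at r3
  refine ⟨n, uU n hn1 P v, r1, r2, r3, fun x hx => ?_⟩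
  have := uU_comm hn1 hP hPs ι₀ hι₀ hε.le x (hXball x hx)
    (fun k => (hp_comm _ (hsI k) x hx).le) hv1
    (fun k => (hv4 k).trans (by linarith [min_le_right (1 / 2 : ℝ) (ε / 4)]))
  refine lt_of_le_of_lt this ?_
  linarith

end
end

section
/- Let A be a unital C*-algebra, μ > 0, and let c ∈ A be a positive invertible element with c ≥ μ·1 (i.e. c − μ·1 is positive). Let c^{-1/2} be defined via the continuous functional calculus. Then for every x ∈ A one has ‖x·c^{-1/2} − c^{-1/2}·x‖ ≤ ‖xc − cx‖ / (2·μ^{3/2}). -/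
theorem statement11_aux {A : Type*} [CStarAlgebra A] [PartialOrder A] [StarOrderedRing A]
    (μ : ℝ) (hμ : 0 < μ) (c : A) (hc_pos : 0 ≤ c)
    (hs : ∀ r ∈ spectrum ℝ c, μ ≤ r) (y : A) :
    2 * Real.sqrt μ * ‖y‖ ≤ ‖cfc Real.sqrt c * y + y * cfc Real.sqrt c‖ := by
  have hsa : IsSelfAdjoint c := IsSelfAdjoint.of_nonneg hc_pos
  set b := cfc Real.sqrt c with hb
  have hm : 0 < Real.sqrt μ := Real.sqrt_pos.mpr hμ
  have key : ∀ ε : ℝ, 0 < ε →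
      2 * Real.sqrt μ * ‖y‖ ≤ ‖b * y + y * b‖ + ε * ‖b * y * b‖ := by
    intro ε hε
    have hpos : ∀ r : ℝ, 1 + ε * Real.sqrt r ≠ 0 := fun r => by positivity
    have hu : cfc (fun r : ℝ => 1 + ε * Real.sqrt r) c = 1 + ε • b := by
      rw [cfc_add (a := c) (fun _ => (1 : ℝ)) (fun r => ε * Real.sqrt r)]
      rw [cfc_const_mul ε Real.sqrt c, cfc_const_one ℝ c]
    have hcont : ContinuousOn (fun r : ℝ => (1 + ε * Real.sqrt r)⁻¹) (spectrum ℝ c) :=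
      ContinuousOn.inv₀ (by fun_prop) (fun r _ => hpos r)
    set g := cfc (fun r : ℝ => (1 + ε * Real.sqrt r)⁻¹) c with hg
    have h1 : g * (1 + ε • b) = 1 := by
      rw [← hu, hg, ← cfc_mul _ _ c hcont (by fun_prop), ← cfc_const_one ℝ c]
      exact cfc_congr fun r _ => inv_mul_cancel₀ (hpos r)
    have h2 : (1 + ε • b) * g = 1 := by
      rw [← hu, hg, ← cfc_mul _ _ c (by fun_prop) hcont, ← cfc_const_one ℝ c]
      exact cfc_congr fun r _ => mul_inv_cancel₀ (hpos r)
    have hgn : ‖g‖ ≤ (1 + ε * Real.sqrt μ)⁻¹ := by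
      refine norm_cfc_le (by positivity) fun r hr => ?_
      rw [Real.norm_of_nonneg (by positivity)]
      have := Real.sqrt_le_sqrt (hs r hr)
      gcongr
    have hy : y = g * ((1 + ε • b) * y * (1 + ε • b)) * g := by
      calc y = (g * (1 + ε • b)) * y * ((1 + ε • b) * g) := by rw [h1, h2]; simp
        _ = _ := by simp only [mul_assoc]
    have hexp : (1 + ε • b) * y * (1 + ε • b) = y + ε • (b * y + y * b) + (ε * ε) • (b * y * b) := by
      simp only [add_mul, mul_add, one_mul, mul_one, smul_mul_assoc, mul_smul_comm, smul_add,
        smul_smul]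
      abel
    set z := (1 + ε • b) * y * (1 + ε • b) with hz
    have hyz : ‖y‖ ≤ (1 + ε * Real.sqrt μ)⁻¹ * ‖z‖ * (1 + ε * Real.sqrt μ)⁻¹ := by
      calc ‖y‖ = ‖g * z * g‖ := by rw [← hy]
        _ ≤ ‖g‖ * ‖z‖ * ‖g‖ := (norm_mul_le _ _).trans (by gcongr; exact norm_mul_le _ _)
        _ ≤ _ := by gcongr
    have hP : 0 < 1 + ε * Real.sqrt μ := by positivity
    have hyz2 : (1 + ε * Real.sqrt μ) ^ 2 * ‖y‖ ≤ ‖z‖ := by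
      calc _ ≤ (1 + ε * Real.sqrt μ) ^ 2 *
            ((1 + ε * Real.sqrt μ)⁻¹ * ‖z‖ * (1 + ε * Real.sqrt μ)⁻¹) := by gcongr
        _ = ‖z‖ := by field_simp
    have hzn : ‖z‖ ≤ ‖y‖ + ε * ‖b * y + y * b‖ + ε * ε * ‖b * y * b‖ := by
      rw [hexp]
      refine (norm_add₃_le).trans ?_
      rw [norm_smul, norm_smul, Real.norm_of_nonneg hε.le,
        Real.norm_of_nonneg (by positivity : 0 ≤ ε * ε)]
    have h0 : 0 ≤ (ε * Real.sqrt μ) ^ 2 * ‖y‖ := by positivity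
    refine le_of_mul_le_mul_left ?_ hε
    nlinarith
  refine le_of_forall_pos_le_add fun δ hδ => ?_
  have hN : 0 < ‖b * y * b‖ + 1 := by positivity
  refine (key (δ / (‖b * y * b‖ + 1)) (by positivity)).trans ?_
  gcongr
  rw [div_mul_eq_mul_div, div_le_iff₀ hN]
  nlinarith

/-- Let `A` be a unital C*-algebra, `μ > 0`, and let `c ∈ A` be a positive
invertible element with `c ≥ μ·1`.  With `c^{-1/2}` defined by the continuous functional
calculus, for every `x ∈ A` one has
`‖x·c^{-1/2} − c^{-1/2}·x‖ ≤ ‖xc − cx‖ / (2·μ^{3/2})`. -/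
theorem statement11 {A : Type*} [CStarAlgebra A] [PartialOrder A] [StarOrderedRing A]
    (μ : ℝ) (hμ : 0 < μ) (c : A) (hc_pos : 0 ≤ c) (hc_unit : IsUnit c)
    (hc_ge : algebraMap ℝ A μ ≤ c) (x : A) :
    ‖x * cfc (fun r : ℝ => (Real.sqrt r)⁻¹) c - cfc (fun r : ℝ => (Real.sqrt r)⁻¹) c * x‖ ≤
      ‖x * c - c * x‖ / (2 * μ ^ ((3 : ℝ) / 2)) := by
  have hsa : IsSelfAdjoint c := IsSelfAdjoint.of_nonneg hc_pos
  have hs : ∀ r ∈ spectrum ℝ c, μ ≤ r := (algebraMap_le_iff_le_spectrum hsa).mp hc_ge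
  have hm : 0 < Real.sqrt μ := Real.sqrt_pos.mpr hμ
  have hne : ∀ r ∈ spectrum ℝ c, Real.sqrt r ≠ 0 := fun r hr =>
    (Real.sqrt_pos.mpr (hμ.trans_le (hs r hr))).ne'
  have hcont : ContinuousOn (fun r : ℝ => (Real.sqrt r)⁻¹) (spectrum ℝ c) :=
    ContinuousOn.inv₀ (by fun_prop) hne
  have hbb : cfc Real.sqrt c * cfc Real.sqrt c = c := by
    rw [← cfc_mul Real.sqrt Real.sqrt c (by fun_prop) (by fun_prop)]
    conv_rhs => rw [← cfc_id ℝ c]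
    exact cfc_congr fun r hr => Real.mul_self_sqrt (hμ.le.trans (hs r hr))
  have aux := statement11_aux μ hμ c hc_pos hs (x * cfc Real.sqrt c - cfc Real.sqrt c * x)
  set g := cfc (fun r : ℝ => (Real.sqrt r)⁻¹) c with hg
  set b := cfc Real.sqrt c with hb
  have h1 : g * b = 1 := by
    rw [hg, hb, ← cfc_mul _ _ c hcont (by fun_prop), ← cfc_const_one ℝ c]
    exact cfc_congr fun r hr => inv_mul_cancel₀ (hne r hr)
  have h2 : b * g = 1 := by
    rw [hg, hb, ← cfc_mul _ _ c (by fun_prop) hcont, ← cfc_const_one ℝ c]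
    exact cfc_congr fun r hr => mul_inv_cancel₀ (hne r hr)
  have hgn : ‖g‖ ≤ (Real.sqrt μ)⁻¹ := by
    refine norm_cfc_le (by positivity) fun r hr => ?_
    rw [Real.norm_of_nonneg (by positivity)]
    have := Real.sqrt_le_sqrt (hs r hr)
    gcongr
  have e1 : b * (x * b - b * x) + (x * b - b * x) * b = x * c - c * x := by
    rw [← hbb]; noncomm_ring
  rw [e1] at aux
  have e2 : x * g - g * x = - (g * (x * b - b * x) * g) := by
    have : g * (x * b - b * x) * g = g * x * (b * g) - (g * b) * x * g := by noncomm_ring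
    rw [this, h1, h2]; simp
  have e3 : μ ^ ((3 : ℝ) / 2) = Real.sqrt μ ^ 3 := by
    rw [Real.sqrt_eq_rpow, ← Real.rpow_natCast, ← Real.rpow_mul hμ.le]; norm_num
  rw [e2, norm_neg, e3, le_div_iff₀ (by positivity)]
  have h4 : ‖g * (x * b - b * x) * g‖ ≤
      (Real.sqrt μ)⁻¹ * ‖x * b - b * x‖ * (Real.sqrt μ)⁻¹ :=
    calc _ ≤ ‖g‖ * ‖x * b - b * x‖ * ‖g‖ :=
          (norm_mul_le _ _).trans (by gcongr; exact norm_mul_le _ _)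
      _ ≤ _ := by gcongr
  calc _ ≤ ((Real.sqrt μ)⁻¹ * ‖x * b - b * x‖ * (Real.sqrt μ)⁻¹) * (2 * Real.sqrt μ ^ 3) := by
        gcongr
    _ = 2 * Real.sqrt μ * ‖x * b - b * x‖ := by field_simp
    _ ≤ _ := aux
end

section
/- Let m ≥ 1, let F be the free group on m generators, let α be an automorphism of F, and let Γ = F ⋊_α ℤ be the semidirect product in which the generator 1 ∈ ℤ acts on F by α. Then the second group homology H₂(Γ;ℤ) of Γ with coefficients in the trivial Γ-module ℤ is isomorphic, as an abelian group, to the subgroup {x ∈ F^{ab} : ᾱ(x) = x} of fixed points of the automorphism ᾱ of the abelianization F^{ab} of F induced by α. In particular, H₂(Γ;ℤ) is a finitely generated free abelian group whose rank equals the multiplicity of 1 as an eigenvalue of the map induced by α on H₁(F;ℝ) ≅ ℝᵐ. -/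
noncomputable section

/-- The free-by-cyclic group `F ⋊_α ℤ` associated to an automorphism `α` of the free group
`F` on `m` generators; the generator `1 ∈ ℤ` acts by `α`. -/
abbrev FreeByCyclic (m : ℕ) (α : FreeGroup (Fin m) ≃* FreeGroup (Fin m)) : Type :=
  FreeGroup (Fin m) ⋊[zpowersHom (MulAut (FreeGroup (Fin m))) α] Multiplicative ℤ

/-! For a group `Γ`, presented via the universal presentation `1 → R → F → Γ → 1` with
`F = FreeGroup Γ` the free group on the underlying set of `Γ` and `R` the kernel of the
canonical surjection, Hopf's formula identifies the second group homology of `Γ` with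
trivial integer coefficients as `H₂(Γ;ℤ) = (R ∩ [F,F]) / [F,R]`.  Since this Mathlib
version does not contain group homology, we use Hopf's formula as the definition of
`H₂(Γ;ℤ)` below. -/

/-- The canonical surjection `FreeGroup Γ →* Γ` of the universal presentation. -/
def univPres (Γ : Type*) [Group Γ] : FreeGroup Γ →* Γ := FreeGroup.lift id

/-- The relation subgroup `R` of the universal presentation. -/
def relSubgroup (Γ : Type*) [Group Γ] : Subgroup (FreeGroup Γ) := (univPres Γ).ker

/-- `R ∩ [F,F]`, the numerator in Hopf's formula. -/
def hopfNumerator (Γ : Type*) [Group Γ] : Subgroup (FreeGroup Γ) :=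
  relSubgroup Γ ⊓ commutator (FreeGroup Γ)

/-- `[F,R]`, the denominator in Hopf's formula. -/
def hopfDenominator (Γ : Type*) [Group Γ] : Subgroup (FreeGroup Γ) :=
  ⁅(⊤ : Subgroup (FreeGroup Γ)), relSubgroup Γ⁆

instance relSubgroup_normal (Γ : Type*) [Group Γ] : (relSubgroup Γ).Normal :=
  MonoidHom.normal_ker _

instance hopfDenominator_normal (Γ : Type*) [Group Γ] : (hopfDenominator Γ).Normal :=
  Subgroup.commutator_normal _ _

instance hopfDenominator_subgroupOf_normal (Γ : Type*) [Group Γ] :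
    ((hopfDenominator Γ).subgroupOf (hopfNumerator Γ)).Normal :=
  Subgroup.Normal.comap inferInstance _

/-- The second group homology `H₂(Γ;ℤ)` of `Γ` with coefficients in the trivial `Γ`-module
`ℤ`, realized via Hopf's formula `H₂(Γ;ℤ) = (R ∩ [F,F]) / [F,R]` for the universal
presentation of `Γ`. -/
def H2 (Γ : Type*) [Group Γ] : Type _ :=
  hopfNumerator Γ ⧸ (hopfDenominator Γ).subgroupOf (hopfNumerator Γ)

instance (Γ : Type*) [Group Γ] : Group (H2 Γ) :=
  inferInstanceAs (Group (hopfNumerator Γ ⧸ (hopfDenominator Γ).subgroupOf (hopfNumerator Γ)))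

/-- The subgroup of fixed points of the automorphism of the abelianization `F^{ab}` induced
by `α`. -/
def fixedSubgroup (m : ℕ) (α : FreeGroup (Fin m) ≃* FreeGroup (Fin m)) :
    Subgroup (Abelianization (FreeGroup (Fin m))) :=
  MonoidHom.eqLocus (Abelianization.map α.toMonoidHom) (MonoidHom.id _)

/-- The linear endomorphism of `H₁(F;ℝ) ≅ ℝᵐ` induced by `α`: the `j`-th column records the
exponent sums of the generators in `α(x_j)`. -/
def inducedLinearMap (m : ℕ) (α : FreeGroup (Fin m) ≃* FreeGroup (Fin m)) :
    (Fin m → ℝ) →ₗ[ℝ] (Fin m → ℝ) :=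
  Matrix.toLin' (Matrix.of fun i j : Fin m =>
    Multiplicative.toAdd
      ((FreeGroup.lift fun l : Fin m =>
          Multiplicative.ofAdd (Pi.single l (1 : ℝ))) (α (FreeGroup.of j))) i)


section CentralExt

variable {N : Type*} [Group N] (α : N ≃* N) {E : Type*} [Group E]

/-- the correction `T s(f) T⁻¹ s(α f)⁻¹` -/
def corr (s : N →* E) (T : E) (f : N) : E := T * s f * T⁻¹ * (s (α f))⁻¹

lemma corr_eq (s : N →* E) (T : E) (f : N) : T * s f * T⁻¹ = corr α s T f * s (α f) := by
  simp [corr]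

/-- the correction as a homomorphism -/
def corrHom (s : N →* E) (T : E) (hc : ∀ f e, Commute (corr α s T f) e) : N →* E where
  toFun := corr α s T
  map_one' := by simp [corr]
  map_mul' f g := by
    have h1 : corr α s T (f * g) = (T * s f * T⁻¹) * (corr α s T g) * (s (α f))⁻¹ := by
      simp [corr, mul_assoc]
    rw [h1, mul_assoc, (hc g _).eq, ← mul_assoc]
    rfl

lemma corr_mul (s : N →* E) (T : E) (hc : ∀ f e, Commute (corr α s T f) e) (f g : N) :
    corr α s T (f * g) = corr α s T f * corr α s T g := (corrHom α s T hc).map_mul f g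

lemma corr_inv (s : N →* E) (T : E) (hc : ∀ f e, Commute (corr α s T f) e) (f : N) :
    corr α s T f⁻¹ = (corr α s T f)⁻¹ := (corrHom α s T hc).map_inv f

lemma corr_one (s : N →* E) (T : E) : corr α s T 1 = 1 := by simp [corr]

lemma corr_ab (s : N →* E) (T : E) (hc : ∀ f e, Commute (corr α s T f) e) {g : N}
    (hg : Abelianization.of g = 1) : corr α s T g = 1 := by
  have h : g ∈ commutator N := by
    rw [← Abelianization.ker_of N]; exact hg
  have h2 : ⁅(⊤ : Subgroup N), ⊤⁆ ≤ (corrHom α s T hc).ker := by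
    rw [Subgroup.commutator_le]
    intro a _ b _
    rw [MonoidHom.mem_ker, map_commutatorElement, commutatorElement_eq_one_iff_commute]
    exact hc a _
  exact h2 h

/-- the subgroup containing all commutators -/
def bigK (s : N →* E) (T : E) (hc : ∀ f e, Commute (corr α s T f) e) : Subgroup E where
  carrier := {x | ∃ g f : N, Abelianization.of f = Abelianization.of (α g) * (Abelianization.of g)⁻¹
    ∧ x = corr α s T g * s f}
  one_mem' := ⟨1, 1, by simp, by simp [corr]⟩
  mul_mem' := by
    rintro _ _ ⟨g, f, h, rfl⟩ ⟨g', f', h', rfl⟩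
    refine ⟨g * g', f * f', ?_, ?_⟩
    · simp only [map_mul, h, h', mul_inv]
      exact mul_mul_mul_comm _ _ _ _
    · rw [corr_mul α s T hc, map_mul, mul_assoc, mul_assoc, ← mul_assoc (s f), ← (hc g' (s f)).eq,
        mul_assoc]
  inv_mem' := by
    rintro _ ⟨g, f, h, rfl⟩
    refine ⟨g⁻¹, f⁻¹, by simp [h, mul_comm], ?_⟩
    rw [corr_inv α s T hc, mul_inv_rev, map_inv, ((hc g _).inv_left).eq]

lemma bigK_of_comm (s : N →* E) (T : E) (hc : ∀ f e, Commute (corr α s T f) e) (f : N)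
    (h : Abelianization.of f = 1) : s f ∈ bigK α s T hc :=
  ⟨1, f, by simpa using h, by simp [corr_one]⟩

lemma map_of_apply (f : N) : Abelianization.map α.toMonoidHom (Abelianization.of f)
    = Abelianization.of (α f) := rfl

/-- the set of elements normalizing -/
lemma bigK_normal (s : N →* E) (T : E) (hc : ∀ f e, Commute (corr α s T f) e)
    (hgen : ∀ e : E, ∃ a ∈ Subgroup.center E, ∃ f : N, ∃ n : ℤ, e = a * s f * T ^ n) :
    (bigK α s T hc).Normal := by
  rw [← Subgroup.normalizer_eq_top_iff, eq_top_iff]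
  have hs : ∀ h : N, ∀ x ∈ bigK α s T hc, s h * x * (s h)⁻¹ ∈ bigK α s T hc := by
    rintro h _ ⟨g, f, hf, rfl⟩
    refine ⟨g, h * f * h⁻¹, by simp [hf], ?_⟩
    rw [← mul_assoc, ← (hc g (s h)).eq]
    simp [mul_assoc]
  have hT : ∀ x ∈ bigK α s T hc, T * x * T⁻¹ ∈ bigK α s T hc := by
    rintro _ ⟨g, f, hf, rfl⟩
    refine ⟨g * f, α f, ?_, ?_⟩
    · simp only [map_mul, hf, mul_inv]
      simp [mul_comm]
    · rw [← mul_assoc, ← (hc g T).eq, corr_mul α s T hc, mul_assoc _ _ (s (α f)), ← corr_eq]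
      simp only [mul_assoc]
  have hT' : ∀ x ∈ bigK α s T hc, T⁻¹ * x * T ∈ bigK α s T hc := by
    rintro _ ⟨g, f, hf, rfl⟩
    obtain ⟨f, rfl⟩ := α.surjective f
    refine ⟨g * f⁻¹, f, ?_, ?_⟩
    · simp only [map_mul, map_inv, mul_inv, inv_inv] at hf ⊢
      have : Abelianization.of (α g) = Abelianization.of (α f) * Abelianization.of g := by
        rw [hf]; simp
      rw [this]
      simp [mul_comm]
    · have h3 : s (α f) = (corr α s T f)⁻¹ * (T * s f * T⁻¹) := by rw [corr_eq α, inv_mul_cancel_left]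
      rw [corr_mul α s T hc, corr_inv α s T hc, h3, ← mul_assoc, ← mul_assoc, ← (hc g T⁻¹).eq,
        mul_assoc _ T⁻¹, ← ((hc f T⁻¹).inv_left).eq]
      simp [mul_assoc]
  have hsn : ∀ h : N, s h ∈ Subgroup.normalizer (bigK α s T hc : Set E) := by
    intro h
    rw [Subgroup.mem_normalizer_iff]
    intro x
    refine ⟨hs h x, fun hx => ?_⟩
    have := hs h⁻¹ _ hx
    simpa [mul_assoc] using this
  have hTn : T ∈ Subgroup.normalizer (bigK α s T hc : Set E) := by
    rw [Subgroup.mem_normalizer_iff]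
    intro x
    refine ⟨hT x, fun hx => ?_⟩
    have := hT' _ hx
    simpa [mul_assoc] using this
  intro e _
  obtain ⟨a, ha, f, n, rfl⟩ := hgen e
  refine mul_mem (mul_mem ?_ (hsn f)) (zpow_mem hTn n)
  exact Subgroup.center_le_normalizer _ ha

lemma commutator_le_bigK (s : N →* E) (T : E) (hc : ∀ f e, Commute (corr α s T f) e)
    (hgen : ∀ e : E, ∃ a ∈ Subgroup.center E, ∃ f : N, ∃ n : ℤ, e = a * s f * T ^ n) :
    commutator E ≤ bigK α s T hc := by
  have := bigK_normal α s T hc hgen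
  let q := QuotientGroup.mk' (bigK α s T hc)
  have hTs : ∀ g, Commute (q T) (q (s g)) := by
    intro g
    rw [← commutatorElement_eq_one_iff_commute, ← map_commutatorElement]
    refine (QuotientGroup.eq_one_iff _).2 ⟨g, α g * g⁻¹, by simp, ?_⟩
    rw [commutatorElement_def, corr_eq α]; simp [mul_assoc]
  have hss : ∀ g h, Commute (q (s g)) (q (s h)) := by
    intro g h
    rw [← commutatorElement_eq_one_iff_commute, ← map_commutatorElement, ← map_commutatorElement]
    refine (QuotientGroup.eq_one_iff _).2 (bigK_of_comm α s T hc _ ?_)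
    rw [map_commutatorElement, commutatorElement_eq_one_iff_commute]
    exact Commute.all _ _
  have hcen : ∀ a ∈ Subgroup.center E, ∀ e, Commute (q a) (q e) := by
    intro a ha e
    have : a * e = e * a := (Subgroup.mem_center_iff.1 ha e).symm
    show q a * q e = q e * q a
    rw [← map_mul, this, map_mul]
  have key : ∀ x y, Commute (q x) (q y) := by
    intro x y
    obtain ⟨a, ha, f, n, rfl⟩ := hgen x
    obtain ⟨b, hb, g, k, rfl⟩ := hgen y
    have h1 : Commute (q (s f)) (q (b * s g * T ^ k)) := by
      rw [map_mul, map_mul, map_zpow]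
      exact (((hcen b hb _).symm).mul_right (hss _ _)).mul_right (((hTs f).symm).zpow_right k)
    have h2 : Commute (q T) (q (b * s g * T ^ k)) := by
      rw [map_mul, map_mul, map_zpow]
      exact (((hcen b hb _).symm).mul_right (hTs _)).mul_right ((Commute.refl _).zpow_right k)
    rw [map_mul, map_mul, map_zpow]
    exact ((hcen a ha _).mul_left h1).mul_left (h2.zpow_left n)
  rw [commutator_def, Subgroup.commutator_le]
  intro x _ y _
  refine (QuotientGroup.eq_one_iff _).1 ?_
  change q _ = 1
  rw [map_commutatorElement, commutatorElement_eq_one_iff_commute]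
  exact key x y

end CentralExt

section Ext

variable (m : ℕ) (α : FreeGroup (Fin m) ≃* FreeGroup (Fin m))

/-- abbreviation for the abelianization -/
abbrev FAb (m : ℕ) : Type := Abelianization (FreeGroup (Fin m))

/-- the automorphism of `F^ab × F` -/
def betaAut : MulAut (FAb m × FreeGroup (Fin m)) where
  toFun p := (p.1 * Abelianization.of p.2, α p.2)
  invFun p := (p.1 * (Abelianization.of (α.symm p.2))⁻¹, α.symm p.2)
  left_inv p := by simp
  right_inv p := by simp
  map_mul' p q := by
    ext <;> simp [mul_mul_mul_comm]

/-- the model central extension -/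
abbrev EHat : Type :=
  (FAb m × FreeGroup (Fin m)) ⋊[zpowersHom (MulAut (FAb m × FreeGroup (Fin m))) (betaAut m α)]
    Multiplicative ℤ

lemma beta_zpow_snd (n : ℤ) (x : FAb m × FreeGroup (Fin m)) :
    ((betaAut m α ^ n) x).2 = ((α : MulAut (FreeGroup (Fin m))) ^ n) x.2 := by
  induction n using Int.induction_on generalizing x with
  | zero => rfl
  | succ k ih => rw [zpow_add_one, zpow_add_one, MulAut.mul_apply, MulAut.mul_apply, ih]; rfl
  | pred k ih => rw [zpow_sub_one, zpow_sub_one, MulAut.mul_apply, MulAut.mul_apply, ih]; rfl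

lemma beta_zpow_fix (n : ℤ) (x : FAb m) :
    (betaAut m α ^ n) (x, 1) = (x, 1) := by
  have h1 : betaAut m α (x, 1) = (x, 1) := by simp [betaAut]
  have h2 : (betaAut m α)⁻¹ (x, 1) = (x, 1) := by
    rw [MulAut.inv_apply, MulEquiv.symm_apply_eq, h1]
  induction n using Int.induction_on with
  | zero => rfl
  | succ k ih => rw [zpow_add_one, MulAut.mul_apply, h1, ih]
  | pred k ih => rw [zpow_sub_one, MulAut.mul_apply, h2, ih]

/-- projection of the model extension -/
def piHat : EHat m α →* FreeByCyclic m α :=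
  SemidirectProduct.map (MonoidHom.snd _ _) (MonoidHom.id _) (by
    intro g
    ext x
    exact beta_zpow_snd m α g.toAdd x)

/-- lift of the universal presentation -/
def PhiHom : FreeGroup (FreeByCyclic m α) →* EHat m α :=
  FreeGroup.lift fun x => ⟨(1, x.left), x.right⟩

lemma piHat_Phi (p : FreeGroup (FreeByCyclic m α)) :
    piHat m α (PhiHom m α p) = univPres _ p := by
  have : (piHat m α).comp (PhiHom m α) = univPres _ := by
    apply FreeGroup.ext_hom
    intro x
    simp only [MonoidHom.comp_apply, PhiHom, univPres, FreeGroup.lift_apply_of]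
    rfl
  exact DFunLike.congr_fun this p

lemma Phi_rel {p : FreeGroup (FreeByCyclic m α)} (hp : p ∈ relSubgroup (FreeByCyclic m α)) :
    PhiHom m α p = SemidirectProduct.inl ((PhiHom m α p).left.1, 1) := by
  have h : piHat m α (PhiHom m α p) = 1 := by rw [piHat_Phi]; exact hp
  have h1 : (PhiHom m α p).left.2 = 1 := congrArg SemidirectProduct.left h
  have h2 : (PhiHom m α p).right = 1 := congrArg SemidirectProduct.right h
  apply SemidirectProduct.ext
  · exact Prod.ext rfl h1
  · exact h2

lemma inl_central (x : FAb m) (e : EHat m α) :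
    Commute (SemidirectProduct.inl (x, 1) : EHat m α) e := by
  apply SemidirectProduct.ext
  · have h : (zpowersHom (MulAut (FAb m × FreeGroup (Fin m))) (betaAut m α)) e.right (x, 1)
      = (x, 1) := beta_zpow_fix m α e.right.toAdd x
    rw [SemidirectProduct.mul_left, SemidirectProduct.mul_left, SemidirectProduct.left_inl, h]
    ext <;> simp [mul_comm]
  · simp

lemma den_le_ker : hopfDenominator (FreeByCyclic m α) ≤ (PhiHom m α).ker := by
  unfold hopfDenominator
  rw [Subgroup.commutator_le]
  intro x _ r hr
  rw [MonoidHom.mem_ker, map_commutatorElement, commutatorElement_eq_one_iff_commute,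
    Phi_rel m α hr]
  exact (inl_central m α _ _).symm

/-- the comparison map -/
def thetaHom : hopfNumerator (FreeByCyclic m α) →* FAb m where
  toFun p := (PhiHom m α p.1).left.1
  map_one' := by simp
  map_mul' p q := by
    have hp := Phi_rel m α p.2.1
    have hq := Phi_rel m α q.2.1
    rw [Subgroup.coe_mul, map_mul, hp, hq, ← map_mul]
    simp

/-- splitting over the free group -/
def sTilde : FreeGroup (Fin m) →* FreeGroup (FreeByCyclic m α) :=
  FreeGroup.lift fun i => FreeGroup.of (SemidirectProduct.inl (FreeGroup.of i))

/-- lift of the stable letter -/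
def tTilde : FreeGroup (FreeByCyclic m α) :=
  FreeGroup.of (SemidirectProduct.inr (Multiplicative.ofAdd 1))

lemma univ_s (f : FreeGroup (Fin m)) :
    univPres _ (sTilde m α f) = (SemidirectProduct.inl f : FreeByCyclic m α) := by
  have : (univPres _).comp (sTilde m α) = SemidirectProduct.inl := by
    apply FreeGroup.ext_hom
    intro x
    simp [sTilde, univPres]
  exact DFunLike.congr_fun this f

lemma univ_t : univPres _ (tTilde m α) =
    (SemidirectProduct.inr (Multiplicative.ofAdd 1) : FreeByCyclic m α) := by
  simp [tTilde, univPres]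

lemma Phi_s (f : FreeGroup (Fin m)) :
    PhiHom m α (sTilde m α f) = SemidirectProduct.inl (1, f) := by
  have : (PhiHom m α).comp (sTilde m α) = SemidirectProduct.inl.comp (MonoidHom.inr _ _) := by
    apply FreeGroup.ext_hom
    intro x
    simp only [MonoidHom.comp_apply, sTilde, PhiHom, FreeGroup.lift_apply_of]
    rfl
  exact DFunLike.congr_fun this f

lemma Phi_t : PhiHom m α (tTilde m α) = SemidirectProduct.inr (Multiplicative.ofAdd 1) := by
  simp only [tTilde, PhiHom, FreeGroup.lift_apply_of]
  rfl

lemma univ_corr (f : FreeGroup (Fin m)) :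
    univPres _ (corr α (sTilde m α) (tTilde m α) f) = 1 := by
  simp only [corr, map_mul, map_inv, univ_s, univ_t]
  rw [← map_inv SemidirectProduct.inr, ← SemidirectProduct.inl_aut]
  simp

lemma Phi_corr (f : FreeGroup (Fin m)) :
    PhiHom m α (corr α (sTilde m α) (tTilde m α) f) =
      SemidirectProduct.inl (Abelianization.of f, 1) := by
  simp only [corr, map_mul, map_inv, Phi_s, Phi_t]
  rw [← map_inv SemidirectProduct.inr, ← SemidirectProduct.inl_aut, ← map_inv, ← map_mul]
  congr 1
  simp [betaAut]

/-- the universal central extension quotient -/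
abbrev EQ : Type := FreeGroup (FreeByCyclic m α) ⧸ hopfDenominator (FreeByCyclic m α)

/-- quotient map -/
def qHom : FreeGroup (FreeByCyclic m α) →* EQ m α := QuotientGroup.mk' _

lemma q_eq_one {p} : qHom m α p = 1 ↔ p ∈ hopfDenominator (FreeByCyclic m α) :=
  QuotientGroup.eq_one_iff _

lemma q_central {r} (hr : r ∈ relSubgroup (FreeByCyclic m α)) (e : EQ m α) :
    Commute (qHom m α r) e := by
  obtain ⟨p, rfl⟩ := QuotientGroup.mk'_surjective _ e
  change Commute _ (qHom m α p)
  apply Commute.symm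
  rw [← commutatorElement_eq_one_iff_commute, ← map_commutatorElement, q_eq_one]
  exact Subgroup.commutator_mem_commutator (Subgroup.mem_top _) hr

lemma q_corr (f : FreeGroup (Fin m)) :
    corr α ((qHom m α).comp (sTilde m α)) (qHom m α (tTilde m α)) f =
      qHom m α (corr α (sTilde m α) (tTilde m α) f) := by
  simp [corr]

lemma q_hc (f : FreeGroup (Fin m)) (e : EQ m α) :
    Commute (corr α ((qHom m α).comp (sTilde m α)) (qHom m α (tTilde m α)) f) e := by
  rw [q_corr]
  exact q_central m α (univ_corr m α f) e

lemma q_gen (e : EQ m α) : ∃ a ∈ Subgroup.center (EQ m α), ∃ f : FreeGroup (Fin m), ∃ n : ℤ,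
    e = a * ((qHom m α).comp (sTilde m α)) f * (qHom m α (tTilde m α)) ^ n := by
  obtain ⟨p, rfl⟩ := QuotientGroup.mk'_surjective _ e
  change ∃ a ∈ Subgroup.center (EQ m α), ∃ f : FreeGroup (Fin m), ∃ n : ℤ, qHom m α p = _
  let f := (univPres _ p).left
  let n : ℤ := (univPres _ p).right.toAdd
  refine ⟨qHom m α (p * (sTilde m α f * tTilde m α ^ n)⁻¹), ?_, f, n, ?_⟩
  · rw [Subgroup.mem_center_iff]
    intro g
    refine (q_central m α ?_ g).eq.symm
    change univPres _ _ = 1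
    rw [map_mul, map_inv, map_mul, map_zpow, univ_s, univ_t, mul_inv_eq_one, ← map_zpow,
      ← ofAdd_zsmul, smul_eq_mul, mul_one]
    exact (SemidirectProduct.inl_left_mul_inr_right _).symm
  · simp [mul_assoc]

lemma num_form {p} (hp : p ∈ hopfNumerator (FreeByCyclic m α)) :
    ∃ g : FreeGroup (Fin m), Abelianization.of (α g) = Abelianization.of g ∧
      qHom m α p = qHom m α (corr α (sTilde m α) (tTilde m α) g) := by
  have h1 : qHom m α p ∈ commutator (EQ m α) := by
    have := Subgroup.mem_map_of_mem (qHom m α) hp.2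
    rw [commutator_def, Subgroup.map_commutator] at this
    exact Subgroup.commutator_mono le_top le_top this
  obtain ⟨g, f, hf, h⟩ := commutator_le_bigK α _ _ (q_hc m α) (q_gen m α) h1
  rw [q_corr, MonoidHom.comp_apply, ← map_mul] at h
  have h2 : p⁻¹ * (corr α (sTilde m α) (tTilde m α) g * sTilde m α f) ∈
      relSubgroup (FreeByCyclic m α) := by
    have : p⁻¹ * (corr α (sTilde m α) (tTilde m α) g * sTilde m α f) ∈
      hopfDenominator (FreeByCyclic m α) := by
      rw [← q_eq_one, map_mul, map_inv, h, inv_mul_cancel]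
    exact Subgroup.commutator_le_right _ _ this
  have h3 : f = 1 := by
    have h4 : univPres _ p = 1 := hp.1
    have h2 : univPres _ (p⁻¹ * (corr α (sTilde m α) (tTilde m α) g * sTilde m α f)) = 1 := h2
    rw [map_mul, map_mul, map_inv, h4, univ_corr, univ_s] at h2
    apply SemidirectProduct.inl_injective (φ := zpowersHom (MulAut (FreeGroup (Fin m))) α)
    simpa using h2
  subst h3
  refine ⟨g, ?_, by simpa using h⟩
  rw [map_one] at hf
  exact (mul_inv_eq_one.1 hf.symm)

lemma Phi_of_q {p p'} (h : qHom m α p = qHom m α p') : PhiHom m α p = PhiHom m α p' := by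
  have : p⁻¹ * p' ∈ hopfDenominator (FreeByCyclic m α) := by
    rw [← q_eq_one, map_mul, map_inv, h, inv_mul_cancel]
  have := den_le_ker m α this
  rw [MonoidHom.mem_ker, map_mul, map_inv, inv_mul_eq_one] at this
  exact this

lemma theta_ker : (thetaHom m α).ker =
    (hopfDenominator (FreeByCyclic m α)).subgroupOf (hopfNumerator (FreeByCyclic m α)) := by
  ext p
  rw [Subgroup.mem_subgroupOf, MonoidHom.mem_ker]
  constructor
  · intro h
    obtain ⟨g, hg, hq⟩ := num_form m α p.2
    have h1 : Abelianization.of g = 1 := by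
      rw [← h]
      change _ = (PhiHom m α p.1).left.1
      rw [Phi_of_q m α hq, Phi_corr]
      rfl
    rw [← q_eq_one, hq, ← q_corr]
    exact corr_ab α _ _ (q_hc m α) h1
  · intro h
    have := den_le_ker m α h
    change (PhiHom m α p.1).left.1 = 1
    rw [this]; rfl

lemma theta_range : (thetaHom m α).range = fixedSubgroup m α := by
  ext x
  constructor
  · rintro ⟨p, rfl⟩
    obtain ⟨g, hg, hq⟩ := num_form m α p.2
    have h1 : thetaHom m α p = Abelianization.of g := by
      change (PhiHom m α p.1).left.1 = _
      rw [Phi_of_q m α hq, Phi_corr]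
      rfl
    rw [h1]
    exact hg
  · intro hx
    obtain ⟨g, rfl⟩ := QuotientGroup.mk_surjective x
    have hg : Abelianization.of (α g) = Abelianization.of g := hx
    refine ⟨⟨corr α (sTilde m α) (tTilde m α) g, univ_corr m α g, ?_⟩, ?_⟩
    · change _ ∈ commutator _
      rw [← Abelianization.ker_of, MonoidHom.mem_ker]
      have h := congrArg (Abelianization.map (sTilde m α)) hg
      rw [Abelianization.map_of, Abelianization.map_of] at h
      simp only [corr, map_mul, map_inv, h]
      rw [mul_comm (Abelianization.of (tTilde m α))]
      simp
    · change (PhiHom m α _).left.1 = _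
      rw [Phi_corr]
      rfl

theorem h2_equiv : Nonempty (H2 (FreeByCyclic m α) ≃* fixedSubgroup m α) :=
  ⟨(QuotientGroup.quotientMulEquivOfEq (theta_ker m α).symm).trans
    ((QuotientGroup.quotientKerEquivRange (thetaHom m α)).trans
      (MulEquiv.subgroupCongr (theta_range m α)))⟩

end Ext

section Rank

open TensorProduct

variable (m : ℕ) (α : FreeGroup (Fin m) ≃* FreeGroup (Fin m))

/-- coordinates on the abelianization -/
def abCoord : Additive (FAb m) ≃+ (Fin m → ℤ) :=
  (FreeAbelianGroup.equivFinsupp (Fin m)).trans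
    (Finsupp.linearEquivFunOnFinite ℤ ℤ (Fin m)).toAddEquiv

lemma abCoord_of (i : Fin m) :
    abCoord m (Additive.ofMul (Abelianization.of (FreeGroup.of i))) = Pi.single i 1 := by
  have : (FreeAbelianGroup.equivFinsupp (Fin m)) (FreeAbelianGroup.of i) = Finsupp.single i 1 :=
    FreeAbelianGroup.toFinsupp_of i
  change (Finsupp.linearEquivFunOnFinite ℤ ℤ (Fin m))
    ((FreeAbelianGroup.equivFinsupp (Fin m)) (FreeAbelianGroup.of i)) = _
  rw [this]
  ext j
  simp [Finsupp.single_apply, Pi.single_apply, eq_comm]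

/-- the induced integral endomorphism -/
def indZ : (Fin m → ℤ) →ₗ[ℤ] (Fin m → ℤ) :=
  (((abCoord m).toAddMonoidHom.comp
    (MonoidHom.toAdditive (Abelianization.map α.toMonoidHom))).comp
      (abCoord m).symm.toAddMonoidHom).toIntLinearMap

lemma indZ_apply (x : FAb m) : indZ m α (abCoord m (Additive.ofMul x)) =
    abCoord m (Additive.ofMul (Abelianization.map α.toMonoidHom x)) := by
  simp [indZ]

/-- integral to real vectors -/
def castV : (Fin m → ℤ) →+ (Fin m → ℝ) where
  toFun v i := (v i : ℝ)
  map_zero' := by ext; simp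
  map_add' v w := by ext; simp

/-- cast coordinates of a word -/
def wordV : FreeGroup (Fin m) →* Multiplicative (Fin m → ℝ) :=
  (AddMonoidHom.toMultiplicative ((castV m).comp (abCoord m).toAddMonoidHom)).comp
    Abelianization.of

lemma wordV_apply (w : FreeGroup (Fin m)) : (wordV m w).toAdd =
    castV m (abCoord m (Additive.ofMul (Abelianization.of w))) := rfl

lemma castV_single (i : Fin m) : castV m (Pi.single i 1) = Pi.single i 1 := by
  ext j
  by_cases h : j = i
  · subst h; simp [castV]
  · simp [castV, h]

lemma wordV_eq : wordV m =
    FreeGroup.lift fun l : Fin m => Multiplicative.ofAdd (Pi.single l (1 : ℝ)) := by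
  apply FreeGroup.ext_hom
  intro i
  rw [FreeGroup.lift_apply_of]
  apply Multiplicative.toAdd.injective
  rw [wordV_apply, abCoord_of, castV_single]
  rfl

lemma ind_wordV (w : FreeGroup (Fin m)) :
    (wordV m (α w)).toAdd = inducedLinearMap m α (wordV m w).toAdd := by
  have : (wordV m).comp α.toMonoidHom =
      (AddMonoidHom.toMultiplicative (inducedLinearMap m α).toAddMonoidHom).comp (wordV m) := by
    apply FreeGroup.ext_hom
    intro i
    apply Multiplicative.toAdd.injective
    change (wordV m (α (FreeGroup.of i))).toAdd =
      inducedLinearMap m α (wordV m (FreeGroup.of i)).toAdd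
    rw [wordV_apply m (FreeGroup.of i), abCoord_of, castV_single, inducedLinearMap,
      ← wordV_eq]
    ext j
    simp
  exact congrArg Multiplicative.toAdd (DFunLike.congr_fun this w)

lemma ind_cast (v : Fin m → ℤ) : castV m (indZ m α v) = inducedLinearMap m α (castV m v) := by
  obtain ⟨x, rfl⟩ := (abCoord m).surjective v
  obtain ⟨w, hw⟩ := QuotientGroup.mk_surjective (Additive.toMul x)
  have hx : x = Additive.ofMul (Abelianization.of w) := by
    exact congrArg Additive.ofMul hw.symm
  subst hx
  rw [indZ_apply, ← wordV_apply, ← ind_wordV]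
  rfl

/-- scalar extension -/
def scal : ℝ ⊗[ℤ] (Fin m → ℤ) ≃ₗ[ℝ] (Fin m → ℝ) := TensorProduct.piScalarRight ℤ ℝ ℝ (Fin m)

lemma scal_tmul (a : ℝ) (v : Fin m → ℤ) : scal m (a ⊗ₜ v) = a • castV m v := by
  ext i
  simp [scal, castV, mul_comm]

lemma scal_comm (x : ℝ ⊗[ℤ] (Fin m → ℤ)) :
    scal m (AlgebraTensorModule.lTensor ℝ ℝ (indZ m α - LinearMap.id) x) =
      (inducedLinearMap m α - LinearMap.id : (Fin m → ℝ) →ₗ[ℝ] (Fin m → ℝ)) (scal m x) := by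
  induction x with
  | zero => simp
  | add x y hx hy => rw [map_add, map_add, hx, hy, map_add, map_add]
  | tmul a v =>
    rw [AlgebraTensorModule.lTensor_tmul, scal_tmul, scal_tmul, map_smul]
    congr 1
    simp [ind_cast]

lemma rank_eq : Module.finrank ℤ (LinearMap.ker (indZ m α - LinearMap.id)) =
    Module.finrank ℝ (LinearMap.ker (inducedLinearMap m α - LinearMap.id)) := by
  rw [← Module.finrank_baseChange (R := ℝ),
    (LinearMap.tensorKerEquiv ℝ ℝ (indZ m α - LinearMap.id)).finrank_eq]
  have : LinearMap.ker (AlgebraTensorModule.lTensor ℝ ℝ (indZ m α - LinearMap.id)) =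
      (LinearMap.ker (inducedLinearMap m α - LinearMap.id)).comap (scal m).toLinearMap := by
    ext x
    rw [Submodule.mem_comap, LinearMap.mem_ker, LinearMap.mem_ker, LinearEquiv.coe_coe,
      ← scal_comm]
    exact (LinearEquiv.map_eq_zero_iff (scal m)).symm
  rw [this]
  exact ((scal m).ofSubmodule' _).finrank_eq

/-- fixed points in coordinates -/
def fixEquiv : fixedSubgroup m α ≃*
    Multiplicative (LinearMap.ker (indZ m α - LinearMap.id)) where
  toFun x := Multiplicative.ofAdd ⟨abCoord m (Additive.ofMul x.1), by
    have h : Abelianization.map α.toMonoidHom x.1 = x.1 := x.2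
    rw [LinearMap.mem_ker, LinearMap.sub_apply, indZ_apply, h]
    simp⟩
  invFun y := ⟨((abCoord m).symm y.toAdd.1).toMul, by
    have h := y.toAdd.2
    change Abelianization.map α.toMonoidHom _ = _
    rw [LinearMap.mem_ker, LinearMap.sub_apply, sub_eq_zero] at h
    apply Additive.ofMul.injective
    apply (abCoord m).injective
    rw [← indZ_apply]
    simpa using h⟩
  left_inv x := by simp
  right_inv y := by simp
  map_mul' x y := by
    apply Multiplicative.toAdd.injective
    apply Subtype.ext
    simp

theorem fix_free : Nonempty (fixedSubgroup m α ≃* Multiplicative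
    (Fin (Module.finrank ℝ (LinearMap.ker (inducedLinearMap m α - LinearMap.id))) → ℤ)) := by
  rw [← rank_eq]
  exact ⟨(fixEquiv m α).trans (AddEquiv.toMultiplicative
    (Module.finBasis ℤ (LinearMap.ker (indZ m α - LinearMap.id))).equivFun.toAddEquiv)⟩

end Rank

/-- For a free-by-cyclic group `Γ = F ⋊_α ℤ`, the second group homology
`H₂(Γ;ℤ)` (with trivial integer coefficients) is isomorphic to the subgroup of fixed points
of the automorphism of `F^{ab}` induced by `α`; in particular, it is a finitely generated
free abelian group whose rank equals the multiplicity of `1` as an eigenvalue of the map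
induced by `α` on `H₁(F;ℝ) ≅ ℝᵐ`. -/
theorem statement17 (m : ℕ) (hm : 1 ≤ m)
    (α : FreeGroup (Fin m) ≃* FreeGroup (Fin m)) :
    Nonempty (H2 (FreeByCyclic m α) ≃* fixedSubgroup m α) ∧
    ∃ r : ℕ,
      Nonempty (H2 (FreeByCyclic m α) ≃* Multiplicative (Fin r → ℤ)) ∧
      r = Module.finrank ℝ (LinearMap.ker (inducedLinearMap m α - LinearMap.id)) := by
  obtain ⟨e⟩ := h2_equiv m α
  obtain ⟨e'⟩ := fix_free m α
  exact ⟨⟨e⟩, _, ⟨e.trans e'⟩, rfl⟩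

end
end
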